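/- arXiv:2110.03268 — 6 statements merged into one kernel-verified Lean document; each statement's English description precedes it below -/
import Mathlib

section
/- Let Γ be a finite group with complete set of irreducible complex characters Irr(Γ) = {χ_1, …, χ_h}, and let α : Γ → ℂ be a class function. Let M be the Γ×Γ complex matrix with entries M_{x,y} = α(y x⁻¹). Then the characteristic polynomial of M equals ∏_{j=1}^{h} (X − λ_j)^{χ_j(1)²}, where λ_j = (1/χ_j(1)) · Σ_{x ∈ Γ} α(x) χ_j(x); that is, the spectrum of M is {[λ_1]^{χ_1(1)²}, …, [λ_h]^{χ_h(1)²}} counted with multiplicity. -/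
open scoped Classical

noncomputable section

open scoped MonoidAlgebra

/-- The representation of `Γ` on `ℂᵈ` obtained by restricting a matrix representation of the group
algebra `ℂ[Γ]`. -/
def FDRep.ofMatrixAlgHom {Γ : Type} [Group Γ] {d : ℕ}
    (φ : ℂ[Γ] →ₐ[ℂ] Matrix (Fin d) (Fin d) ℂ) : FDRep ℂ Γ :=
  FDRep.of (((Matrix.toLinAlgEquiv' : Matrix (Fin d) (Fin d) ℂ ≃ₐ[ℂ] _).toAlgHom.comp
    φ : ℂ[Γ] →* Module.End ℂ (Fin d → ℂ)).comp (MonoidAlgebra.of ℂ Γ))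

theorem FDRep.character_ofMatrixAlgHom {Γ : Type} [Group Γ] {d : ℕ}
    (φ : ℂ[Γ] →ₐ[ℂ] Matrix (Fin d) (Fin d) ℂ) (g : Γ) :
    (FDRep.ofMatrixAlgHom φ).character g = (φ (MonoidAlgebra.single g 1)).trace := by
  have : (FDRep.ofMatrixAlgHom φ).character g
      = LinearMap.trace ℂ (Fin d → ℂ) (Matrix.toLin' (φ (MonoidAlgebra.single g 1))) := rfl
  rw [this, Matrix.trace_toLin'_eq]

theorem FDRep.trace_matrixAlgHom {Γ : Type} [Group Γ] [Fintype Γ] {d : ℕ}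
    (φ : ℂ[Γ] →ₐ[ℂ] Matrix (Fin d) (Fin d) ℂ) (a : ℂ[Γ]) :
    (φ a).trace = ∑ g, a.coeff g * (FDRep.ofMatrixAlgHom φ).character g := by
  simp_rw [FDRep.character_ofMatrixAlgHom]
  conv_lhs => rw [← (MonoidAlgebra.basis Γ ℂ).sum_repr a]
  simp only [map_sum, Matrix.trace_sum, map_smul, Matrix.trace_smul, MonoidAlgebra.basis_apply,
    smul_eq_mul]
  rfl

theorem FDRep.simple_ofMatrixAlgHom {Γ : Type} [Group Γ] [Fintype Γ] {d : ℕ} [NeZero d]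
    (φ : ℂ[Γ] →ₐ[ℂ] Matrix (Fin d) (Fin d) ℂ) (hφ : Function.Surjective φ) :
    CategoryTheory.Simple (FDRep.ofMatrixAlgHom φ) := by
  let ρ : Representation ℂ Γ (Fin d → ℂ) := (FDRep.ofMatrixAlgHom φ).ρ
  have hρ (g : Γ) : ρ g = Matrix.toLin' (φ (MonoidAlgebra.single g 1)) := rfl
  rw [FDRep.simple_iff_end_is_rank_one,
    ← (Representation.linHom.invariantsEquivFDRepHom _ _).finrank_eq]
  change Module.finrank ℂ (Representation.linHom ρ ρ).invariants = 1
  have hinv (f : (Fin d → ℂ) →ₗ[ℂ] (Fin d → ℂ)) (g : Γ) :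
      Representation.linHom ρ ρ g f = f ↔ f ∘ₗ ρ g = ρ g ∘ₗ f :=
    Representation.linHom.mem_invariants_iff_comm (X := Rep.of ρ) (Y := Rep.of ρ) f g
  have hone : (LinearMap.id : (Fin d → ℂ) →ₗ[ℂ] _) ∈ (Representation.linHom ρ ρ).invariants := by
    exact fun g => (hinv _ g).2 rfl
  refine finrank_eq_one (⟨_, hone⟩ : (Representation.linHom ρ ρ).invariants) ?_ ?_
  · intro h0
    have := congrArg (fun f => f.1 (fun _ => 1) 0) h0
    simp at this
  · rintro ⟨f, hf⟩
    have hcomm (g : Γ) : f ∘ₗ ρ g = ρ g ∘ₗ f :=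
      (hinv f g).1 (hf g)
    have hmem : LinearMap.toMatrix' f ∈ Set.range (Matrix.scalar (Fin d)) := by
      rw [← Matrix.center_eq_range, Semigroup.mem_center_iff]
      intro B
      obtain ⟨a, rfl⟩ := hφ B
      induction a using MonoidAlgebra.induction_linear with
      | zero => simp
      | add f g hf hg => rw [map_add, add_mul, mul_add, hf, hg]
      | single g r =>
        have := congrArg LinearMap.toMatrix' (hcomm g)
        rw [hρ, LinearMap.toMatrix'_comp, LinearMap.toMatrix'_comp, LinearMap.toMatrix'_toLin']
          at this
        have hr : MonoidAlgebra.single g r = r • MonoidAlgebra.single g (1 : ℂ) := by simp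
        rw [hr, map_smul, smul_mul_assoc, mul_smul_comm, this]
    obtain ⟨c, hc⟩ := hmem
    refine ⟨c, Subtype.ext ?_⟩
    apply LinearMap.toMatrix'.injective
    rw [← hc]
    simp [Matrix.smul_one_eq_diagonal]

theorem MonoidAlgebra.trace_mulLeft_single {Γ : Type} [Group Γ] [Fintype Γ] (g : Γ) :
    LinearMap.trace ℂ ℂ[Γ] (LinearMap.mulLeft ℂ (MonoidAlgebra.single g 1))
      = if g = 1 then (Fintype.card Γ : ℂ) else 0 := by
  rw [LinearMap.trace_eq_matrix_trace ℂ (MonoidAlgebra.basis Γ ℂ), Matrix.trace]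
  simp only [Matrix.diag, LinearMap.toMatrix_apply, MonoidAlgebra.basis_apply,
    LinearMap.mulLeft_apply, MonoidAlgebra.single_mul_single]
  have (x y : Γ) : (MonoidAlgebra.basis Γ ℂ).repr (MonoidAlgebra.single y (1*1)) x
      = if y = x then 1 else 0 := by
    rw [mul_one, ← MonoidAlgebra.basis_apply, Module.Basis.repr_self, Finsupp.single_apply]
  simp only [this, mul_eq_right]
  split_ifs <;> simp

theorem Matrix.trace_mulLeft_pi {n : ℕ} (d : Fin n → ℕ)
    (A : Π i, Matrix (Fin (d i)) (Fin (d i)) ℂ) :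
    LinearMap.trace ℂ _ (LinearMap.mulLeft ℂ A) = ∑ i, (d i : ℂ) * (A i).trace := by
  rw [LinearMap.trace_eq_matrix_trace ℂ (Pi.basis fun i => Matrix.stdBasis ℂ _ _), Matrix.trace]
  simp only [Matrix.diag, LinearMap.toMatrix_apply, LinearMap.mulLeft_apply, Pi.basis_repr,
    Pi.basis_apply, Pi.mul_apply, Pi.single_eq_same, Fintype.sum_sigma, Fintype.sum_prod_type]
  refine Finset.sum_congr rfl fun i _ => ?_
  have (B : Matrix (Fin (d i)) (Fin (d i)) ℂ) (p q) :
      (Matrix.stdBasis ℂ _ _).repr B (p, q) = B p q := rfl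
  simp [this, Matrix.stdBasis_eq_single, Finset.mul_sum, Matrix.trace]

theorem Matrix.charpoly_mulLeft_pi_scalar {n : ℕ} (d : Fin n → ℕ) (c : Fin n → ℂ) :
    (LinearMap.mulLeft ℂ (fun i => Matrix.scalar (Fin (d i)) (c i))).charpoly
      = ∏ i, (Polynomial.X - Polynomial.C (c i)) ^ (d i) ^ 2 := by
  rw [← LinearMap.charpoly_toMatrix _ (Pi.basis fun i => Matrix.stdBasis ℂ _ _)]
  have : LinearMap.toMatrix (Pi.basis fun i => Matrix.stdBasis ℂ (Fin (d i)) (Fin (d i)))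
      (Pi.basis fun i => Matrix.stdBasis ℂ (Fin (d i)) (Fin (d i)))
      (LinearMap.mulLeft ℂ (fun i => Matrix.scalar (Fin (d i)) (c i)))
      = Matrix.diagonal fun p => c p.1 := by
    ext p q
    have : LinearMap.mulLeft ℂ (fun i => Matrix.scalar (Fin (d i)) (c i))
        (Pi.basis (fun i => Matrix.stdBasis ℂ (Fin (d i)) (Fin (d i))) q)
        = c q.1 • Pi.basis (fun i => Matrix.stdBasis ℂ (Fin (d i)) (Fin (d i))) q := by
      rw [Pi.basis_apply, LinearMap.mulLeft_apply]
      ext1 i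
      obtain rfl | hi := eq_or_ne i q.1
      · simp [← Matrix.smul_eq_diagonal_mul]
      · simp [Pi.single_eq_of_ne hi]
    rw [LinearMap.toMatrix_apply, this, map_smul, Module.Basis.repr_self, Finsupp.smul_apply,
      Finsupp.single_apply, Matrix.diagonal_apply]
    by_cases h : q = p
    · simp [h]
    · simp [h, Ne.symm h]
  rw [this, Matrix.charpoly_diagonal, Fintype.prod_sigma]
  simp [sq]

/-- The element of the group algebra with prescribed coefficients. -/
def MonoidAlgebra.ofFun {Γ : Type} [Group Γ] [Fintype Γ] (α : Γ → ℂ) : ℂ[Γ] :=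
  ∑ x, MonoidAlgebra.single x (α x)

theorem MonoidAlgebra.coeff_ofFun {Γ : Type} [Group Γ] [Fintype Γ] (α : Γ → ℂ) (g : Γ) :
    (MonoidAlgebra.ofFun α).coeff g = α g := by
  simp [MonoidAlgebra.ofFun, Finsupp.single_apply]

theorem MonoidAlgebra.mul_ofFun_comm {Γ : Type} [Group Γ] [Fintype Γ] (α : Γ → ℂ)
    (hclass : ∀ g x : Γ, α (x * g * x⁻¹) = α g) (a : ℂ[Γ]) :
    a * MonoidAlgebra.ofFun α = MonoidAlgebra.ofFun α * a := by
  induction a using MonoidAlgebra.induction_linear with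
  | zero => simp
  | add f g hf hg => rw [add_mul, mul_add, hf, hg]
  | single g r =>
    simp only [MonoidAlgebra.ofFun, Finset.mul_sum, Finset.sum_mul,
      MonoidAlgebra.single_mul_single]
    refine Fintype.sum_equiv (MulAut.conj g).toEquiv _ _ fun x => ?_
    simp [hclass, mul_comm]

theorem MonoidAlgebra.charpoly_mulLeft_ofFun {Γ : Type} [Group Γ] [Fintype Γ] [DecidableEq Γ]
    (α : Γ → ℂ) :
    (Matrix.of fun x y : Γ => α (y * x⁻¹)).charpoly
      = (LinearMap.mulLeft ℂ (MonoidAlgebra.ofFun α)).charpoly := by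
  rw [← Matrix.charpoly_transpose, ← LinearMap.charpoly_toMatrix _ (MonoidAlgebra.basis Γ ℂ)]
  congr 1
  ext x y
  have (a : ℂ[Γ]) : (MonoidAlgebra.basis Γ ℂ).repr a x = a.coeff x := rfl
  simp [LinearMap.toMatrix_apply, this, MonoidAlgebra.coeff_ofFun]

theorem LinearMap.conj_mulLeft_algEquiv {R A B : Type*} [CommSemiring R] [Semiring A]
    [Semiring B] [Algebra R A] [Algebra R B] (e : A ≃ₐ[R] B) (a : A) :
    e.toLinearEquiv.conj (LinearMap.mulLeft R a) = LinearMap.mulLeft R (e a) := by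
  ext b
  simp [LinearEquiv.conj_apply]

theorem AlgEquiv.surjective_evalAlgHom_comp {R A ι : Type*} {B : ι → Type*} [CommSemiring R]
    [Semiring A] [∀ i, Semiring (B i)] [Algebra R A] [∀ i, Algebra R (B i)]
    (e : A ≃ₐ[R] Π i, B i) (i : ι) :
    Function.Surjective ((Pi.evalAlgHom R B i).comp e.toAlgHom) :=
  (Function.surjective_eval i).comp e.surjective

/-- The regular character, expressed through a Wedderburn decomposition of the group algebra. -/
theorem FDRep.sum_mul_character_ofMatrixAlgHom {Γ : Type} [Group Γ] [Fintype Γ] {n : ℕ}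
    {m : Fin n → ℕ} (e : ℂ[Γ] ≃ₐ[ℂ] Π i, Matrix (Fin (m i)) (Fin (m i)) ℂ) (g : Γ) :
    ∑ i, (m i : ℂ) *
        (FDRep.ofMatrixAlgHom ((Pi.evalAlgHom ℂ _ i).comp e.toAlgHom)).character g
      = if g = 1 then (Fintype.card Γ : ℂ) else 0 := by
  rw [← MonoidAlgebra.trace_mulLeft_single, ← LinearMap.trace_conj' _ e.toLinearEquiv,
    LinearMap.conj_mulLeft_algEquiv, Matrix.trace_mulLeft_pi]
  simp [FDRep.character_ofMatrixAlgHom]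

/-- Every irreducible character occurs in the Wedderburn decomposition of the group algebra. -/
theorem FDRep.exists_character_eq_ofMatrixAlgHom {Γ : Type} [Group Γ] [Fintype Γ] {n : ℕ}
    {m : Fin n → ℕ} [∀ i, NeZero (m i)]
    (e : ℂ[Γ] ≃ₐ[ℂ] Π i, Matrix (Fin (m i)) (Fin (m i)) ℂ)
    (V : FDRep ℂ Γ) [CategoryTheory.Simple V] :
    ∃ i, (FDRep.ofMatrixAlgHom ((Pi.evalAlgHom ℂ _ i).comp e.toAlgHom)).character
      = V.character := by
  by_contra! hne
  have : Invertible (Nat.card Γ : ℂ) := invertibleOfNonzero (NeZero.ne _)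
  have horth (i) : ∑ g, (FDRep.ofMatrixAlgHom
      ((Pi.evalAlgHom ℂ _ i).comp e.toAlgHom)).character g * V.character g⁻¹ = 0 := by
    have := FDRep.simple_ofMatrixAlgHom _ (AlgEquiv.surjective_evalAlgHom_comp e i)
    have h := FDRep.char_orthonormal
      (FDRep.ofMatrixAlgHom ((Pi.evalAlgHom ℂ _ i).comp e.toAlgHom)) V
    rw [if_neg fun ⟨f⟩ => hne i (FDRep.char_iso f)] at h
    exact (mul_eq_zero.1 h).resolve_left (inv_ne_zero (NeZero.ne _))
  have hdim : (Fintype.card Γ : ℂ) * V.character 1 = 0 := calc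
    _ = ∑ g : Γ, (if g = 1 then (Fintype.card Γ : ℂ) else 0) * V.character g⁻¹ := by simp
    _ = ∑ i, (m i : ℂ) * ∑ g, (FDRep.ofMatrixAlgHom
          ((Pi.evalAlgHom ℂ _ i).comp e.toAlgHom)).character g * V.character g⁻¹ := by
      simp_rw [← FDRep.sum_mul_character_ofMatrixAlgHom e, Finset.sum_mul, Finset.mul_sum]
      rw [Finset.sum_comm]
      simp_rw [mul_assoc]
    _ = 0 := by simp [horth]
  have hV : Module.finrank ℂ V = 0 := by simpa using hdim
  have : Subsingleton V := Module.finrank_zero_iff.1 hV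
  have h1 := FDRep.char_orthonormal V V
  have h0 (g : Γ) : V.character g = 0 := by
    rw [FDRep.character, Subsingleton.elim (V.ρ g) 0, map_zero]
  rw [if_pos ⟨CategoryTheory.Iso.refl V⟩] at h1
  simp [h0] at h1

/-- The representations in a Wedderburn decomposition have pairwise distinct characters. -/
theorem FDRep.character_ofMatrixAlgHom_injective {Γ : Type} [Group Γ] [Fintype Γ] {n : ℕ}
    {m : Fin n → ℕ} [∀ i, NeZero (m i)]
    (e : ℂ[Γ] ≃ₐ[ℂ] Π i, Matrix (Fin (m i)) (Fin (m i)) ℂ) :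
    Function.Injective fun i =>
      (FDRep.ofMatrixAlgHom ((Pi.evalAlgHom ℂ _ i).comp e.toAlgHom)).character := by
  intro i j hij
  by_contra hne
  have h := FDRep.trace_matrixAlgHom ((Pi.evalAlgHom ℂ _ i).comp e.toAlgHom)
    (e.symm (Pi.single i 1))
  simp only at hij
  rw [hij, ← FDRep.trace_matrixAlgHom] at h
  simp [Pi.single_eq_of_ne (Ne.symm hne), NeZero.ne] at h

/-- The spectrum of the Cayley color digraph `Cay(Γ, α)` of a finite group `Γ` with class
function `α` is `{[λ_1]^{d_1²}, …, [λ_h]^{d_h²}}` where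
`λ_j = (1/χ_j(1)) Σ_x α(x) χ_j(x)` and `d_j = χ_j(1)`. -/
theorem cayley_color_digraph_charpoly
    (Γ : Type) [Group Γ] [Fintype Γ] [DecidableEq Γ]
    (α : Γ → ℂ) (hclass : ∀ g x : Γ, α (x * g * x⁻¹) = α g)
    (h : ℕ) (χ : Fin h → Γ → ℂ)
    (hirr : ∀ j, ∃ V : FDRep ℂ Γ, CategoryTheory.Simple V ∧ χ j = V.character)
    (hdistinct : Function.Injective χ)
    (hcomplete : ∀ V : FDRep ℂ Γ, CategoryTheory.Simple V → ∃ j, χ j = V.character)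
    (d : Fin h → ℕ) (hd : ∀ j, χ j 1 = d j) :
    (Matrix.of fun x y : Γ => α (y * x⁻¹)).charpoly
      = ∏ j : Fin h,
          (Polynomial.X - Polynomial.C ((1 / χ j 1) * ∑ x : Γ, α x * χ j x)) ^ (d j) ^ 2 := by
  have := IsSemisimpleRing.exists_algEquiv_pi_matrix_of_isAlgClosed ℂ ℂ[Γ]
  obtain ⟨n, m, hm, ⟨e⟩⟩ := this
  let φ (i : Fin n) : ℂ[Γ] →ₐ[ℂ] Matrix (Fin (m i)) (Fin (m i)) ℂ :=
    (Pi.evalAlgHom ℂ _ i).comp e.toAlgHom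
  have hsurj (i) : Function.Surjective (φ i) := AlgEquiv.surjective_evalAlgHom_comp e i
  choose σ hσ using fun i => hcomplete _ (FDRep.simple_ofMatrixAlgHom (φ i) (hsurj i))
  have hσ_bij : Function.Bijective σ := by
    constructor
    · intro i j hij
      apply FDRep.character_ofMatrixAlgHom_injective e
      change (FDRep.ofMatrixAlgHom (φ i)).character = (FDRep.ofMatrixAlgHom (φ j)).character
      rw [← hσ, ← hσ, hij]
    · intro j
      obtain ⟨V, hV, hVj⟩ := hirr j
      obtain ⟨i, hi⟩ := FDRep.exists_character_eq_ofMatrixAlgHom e V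
      exact ⟨i, hdistinct ((hσ i).trans (hi.trans hVj.symm))⟩
  have hχ_one (i) : χ (σ i) 1 = m i := by
    rw [hσ, FDRep.character_ofMatrixAlgHom, ← MonoidAlgebra.one_def, map_one]
    simp
  have hdm (i) : d (σ i) = m i := by exact_mod_cast (hd (σ i)).symm.trans (hχ_one i)
  have hscalar (i) : φ i (MonoidAlgebra.ofFun α)
      = Matrix.scalar _ ((1 / χ (σ i) 1) * ∑ x : Γ, α x * χ (σ i) x) := by
    have hmem : φ i (MonoidAlgebra.ofFun α) ∈ Set.range (Matrix.scalar (Fin (m i))) := by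
      rw [← Matrix.center_eq_range, Semigroup.mem_center_iff]
      intro B
      obtain ⟨a, rfl⟩ := hsurj i B
      rw [← map_mul, MonoidAlgebra.mul_ofFun_comm α hclass, map_mul]
    obtain ⟨c, hc⟩ := hmem
    have htr := FDRep.trace_matrixAlgHom (φ i) (MonoidAlgebra.ofFun α)
    simp_rw [MonoidAlgebra.coeff_ofFun, ← hσ i] at htr
    rw [← htr, hχ_one, ← hc]
    congr 1
    have := NeZero.ne (m i : ℂ)
    simp [Matrix.trace]
    field_simp
  have he : e (MonoidAlgebra.ofFun α) = fun i => Matrix.scalar (Fin (m i))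
      ((1 / χ (σ i) 1) * ∑ x : Γ, α x * χ (σ i) x) := funext hscalar
  rw [MonoidAlgebra.charpoly_mulLeft_ofFun, ← LinearEquiv.charpoly_conj e.toLinearEquiv,
    LinearMap.conj_mulLeft_algEquiv, he, Matrix.charpoly_mulLeft_pi_scalar]
  refine Fintype.prod_equiv (Equiv.ofBijective σ hσ_bij) _ _ fun i => ?_
  rw [Equiv.ofBijective_apply, hdm]
end
end

section
/- Let Γ be a finite group, S ⊆ Γ with 1 ∉ S, and suppose S is a union of conjugacy classes of Γ (so Cay(Γ,S) is a normal mixed Cayley graph). Let Irr(Γ) = {χ_1, …, χ_h}. Then the characteristic polynomial of the Hermitian adjacency matrix H of Cay(Γ,S) equals ∏_{j=1}^{h} (X − γ_j)^{χ_j(1)²}, where γ_j = λ_j + μ_j, λ_j = (1/χ_j(1)) · Σ_{s ∈ S∖S̄} χ_j(s), and μ_j = (i/χ_j(1)) · Σ_{s ∈ S̄} (χ_j(s) − χ_j(s⁻¹)). -/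
open scoped Classical

noncomputable section

/-- The Hermitian adjacency matrix of the mixed Cayley graph `Cay(Γ, S)`. -/
def hermitianAdjMatrix {Γ : Type} [Group Γ] [Fintype Γ] [DecidableEq Γ]
    (S : Finset Γ) : Matrix Γ Γ ℂ :=
  Matrix.of fun a b =>
    if b * a⁻¹ ∈ S then (if a * b⁻¹ ∈ S then 1 else Complex.I)
    else (if a * b⁻¹ ∈ S then -Complex.I else 0)

/-- The representation of `Γ` afforded by a matrix representation of its group algebra. -/
def matrixRep {Γ : Type} [Group Γ] {n : ℕ}
    (f : MonoidAlgebra ℂ Γ →ₐ[ℂ] Matrix (Fin n) (Fin n) ℂ) :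
    Representation ℂ Γ (Fin n → ℂ) :=
  ((Matrix.toLinAlgEquiv' : Matrix (Fin n) (Fin n) ℂ ≃ₐ[ℂ] _).toAlgHom.comp f :
    MonoidAlgebra ℂ Γ →* Module.End ℂ (Fin n → ℂ)).comp (MonoidAlgebra.of ℂ Γ)

theorem matrixRep_character {Γ : Type} [Group Γ] {n : ℕ}
    (f : MonoidAlgebra ℂ Γ →ₐ[ℂ] Matrix (Fin n) (Fin n) ℂ) (g : Γ) :
    (FDRep.of (matrixRep f)).character g = (f (MonoidAlgebra.of ℂ Γ g)).trace :=
  Matrix.trace_toLin'_eq _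

theorem matrixRep_isIrreducible {Γ : Type} [Group Γ] {n : ℕ} [NeZero n]
    (f : MonoidAlgebra ℂ Γ →ₐ[ℂ] Matrix (Fin n) (Fin n) ℂ) (hf : Function.Surjective f) :
    (matrixRep f).IsIrreducible := by
  have stable (W : Subrepresentation (matrixRep f)) (w : Fin n → ℂ) (hw : w ∈ W.toSubmodule)
      (a : MonoidAlgebra ℂ Γ) : (f a).mulVec w ∈ W.toSubmodule := by
    induction a using MonoidAlgebra.induction_on with
    | of g => exact W.apply_mem_toSubmodule g hw
    | add x y hx hy =>
      rw [map_add, Matrix.add_mulVec]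
      exact W.toSubmodule.add_mem hx hy
    | smul r x hx =>
      rw [map_smul, Matrix.smul_mulVec]
      exact W.toSubmodule.smul_mem r hx
  refine { exists_pair_ne := ⟨⊥, ⊤, ?_⟩, eq_bot_or_eq_top := fun W => ?_ }
  · intro h
    have h' : (⊥ : Submodule ℂ (Fin n → ℂ)) = ⊤ :=
      congrArg Subrepresentation.toSubmodule h
    exact bot_ne_top h'
  · by_cases hW : W.toSubmodule = ⊥
    · exact Or.inl (Subrepresentation.toSubmodule_injective hW)
    · right
      apply Subrepresentation.toSubmodule_injective
      obtain ⟨w, hw, hw0⟩ := Submodule.exists_mem_ne_zero_of_ne_bot hW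
      obtain ⟨k, hk⟩ := Function.ne_iff.mp hw0
      refine Submodule.eq_top_iff'.mpr fun v => ?_
      obtain ⟨a, ha⟩ := hf (Matrix.vecMulVec v (Pi.single k (w k)⁻¹))
      have := stable W w hw a
      have hk' : w k ≠ 0 := hk
      rwa [ha, Matrix.vecMulVec_mulVec, single_dotProduct, inv_mul_cancel₀ hk',
        MulOpposite.op_one, one_smul] at this

theorem matrixRep_simple {Γ : Type} [Group Γ] [Fintype Γ] {n : ℕ} [NeZero n]
    (f : MonoidAlgebra ℂ Γ →ₐ[ℂ] Matrix (Fin n) (Fin n) ℂ) (hf : Function.Surjective f) :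
    CategoryTheory.Simple (FDRep.of (matrixRep f)) := by
  have := matrixRep_isIrreducible f hf
  have := invertibleOfNonzero (NeZero.ne (Nat.card Γ : ℂ))
  rw [FDRep.simple_iff_char_is_norm_one]
  have key := Representation.char_orthonormal (matrixRep f) (matrixRep f)
  rw [if_pos ⟨Representation.Equiv.refl _⟩, inv_mul_eq_one₀ (NeZero.ne _)] at key
  exact key.symm

/-- A central element of a product of matrix algebras is a scalar in each factor. -/
theorem exists_eq_smul_one_of_central {ι : Type*} [DecidableEq ι] {d : ι → ℕ}
    (z : Π i, Matrix (Fin (d i)) (Fin (d i)) ℂ) (hz : ∀ x, z * x = x * z) (i : ι) :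
    ∃ c : ℂ, z i = c • 1 := by
  have : z i ∈ Set.range (Matrix.scalar (Fin (d i))) := by
    rw [Matrix.mem_range_scalar_iff_commute_single']
    intro a b
    simpa [commute_iff_eq] using (congrFun (hz (Pi.single i (Matrix.single a b 1))) i).symm
  obtain ⟨c, hc⟩ := this
  exact ⟨c, by rw [← hc, Matrix.scalar_apply, Matrix.smul_one_eq_diagonal]⟩

/-- The characteristic polynomial of multiplication by an element of a product of matrix algebras
which is scalar in each factor. -/
theorem charpoly_lmul_pi_matrix {m : ℕ} {d : Fin m → ℕ}
    (z : Π i, Matrix (Fin (d i)) (Fin (d i)) ℂ) (c : Fin m → ℂ) (hz : ∀ i, z i = c i • 1) :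
    (Algebra.lmul ℂ (Π i, Matrix (Fin (d i)) (Fin (d i)) ℂ) z).charpoly =
      ∏ i, (Polynomial.X - Polynomial.C (c i)) ^ (d i) ^ 2 := by
  let b := Pi.basis fun i => Matrix.stdBasis ℂ (Fin (d i)) (Fin (d i))
  have : LinearMap.toMatrix b b (Algebra.lmul ℂ _ z) =
      Matrix.diagonal fun p : (Σ i, Fin (d i) × Fin (d i)) => c p.1 := by
    ext p q
    have hq : z * b q = c q.1 • b q := by
      ext i : 1
      rw [Pi.mul_apply, hz, Pi.smul_apply, smul_mul_assoc, one_mul, Pi.basis_apply]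
      by_cases h : i = q.1
      · rw [h]
      · simp [Pi.single_eq_of_ne h]
    rw [LinearMap.toMatrix_apply, Algebra.coe_lmul_eq_mul, LinearMap.mul_apply', hq, map_smul,
      Module.Basis.repr_self, Matrix.diagonal_apply]
    by_cases h : p = q
    · simp [h]
    · simp [h]
  rw [← LinearMap.charpoly_toMatrix _ b, this, Matrix.charpoly_diagonal, Fintype.prod_sigma]
  simp [sq]

section GroupAlgebra

variable {Γ : Type} [Group Γ]

/-- The element of the group algebra with coefficients `α`. -/
def ofCoeffs [Fintype Γ] (α : Γ → ℂ) : MonoidAlgebra ℂ Γ := ∑ g, α g • MonoidAlgebra.of ℂ Γ g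

theorem coeff_ofCoeffs [Fintype Γ] (α : Γ → ℂ) (g : Γ) : (ofCoeffs α).coeff g = α g := by
  simp [ofCoeffs, MonoidAlgebra.coeff_sum, Finsupp.single_apply]

theorem ofCoeffs_central [Fintype Γ] (α : Γ → ℂ) (hα : ∀ g x, α (x * g * x⁻¹) = α g)
    (a : MonoidAlgebra ℂ Γ) : ofCoeffs α * a = a * ofCoeffs α := by
  induction a using MonoidAlgebra.induction_on with
  | of x =>
    rw [ofCoeffs, Finset.sum_mul, Finset.mul_sum,
      ← Equiv.sum_comp (MulAut.conj x).toEquiv]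
    refine Finset.sum_congr rfl fun g _ => ?_
    simp [hα, MonoidAlgebra.single_mul_single]
  | add x y hx hy => rw [mul_add, add_mul, hx, hy]
  | smul r x hx => rw [mul_smul_comm, smul_mul_assoc, hx]

theorem leftMulMatrix_ofCoeffs [Fintype Γ] [DecidableEq Γ] (α : Γ → ℂ) (a b : Γ) :
    Algebra.leftMulMatrix (MonoidAlgebra.basis Γ ℂ) (ofCoeffs α) a b = α (a * b⁻¹) := by
  rw [Algebra.leftMulMatrix_eq_repr_mul, MonoidAlgebra.basis_apply]
  change (ofCoeffs α * MonoidAlgebra.single b 1).coeff a = _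
  rw [MonoidAlgebra.coeff_mul_single_apply, coeff_ofCoeffs, mul_one]

theorem trace_map_ofCoeffs [Fintype Γ] {n : ℕ}
    (f : MonoidAlgebra ℂ Γ →ₐ[ℂ] Matrix (Fin n) (Fin n) ℂ) (α : Γ → ℂ) :
    (f (ofCoeffs α)).trace = ∑ g, α g * (FDRep.of (matrixRep f)).character g := by
  simp [ofCoeffs, matrixRep_character, Matrix.trace_sum, -MonoidAlgebra.of_apply]

theorem trace_map_eq_of_character_eq {m n : ℕ}
    (f : MonoidAlgebra ℂ Γ →ₐ[ℂ] Matrix (Fin m) (Fin m) ℂ)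
    (f' : MonoidAlgebra ℂ Γ →ₐ[ℂ] Matrix (Fin n) (Fin n) ℂ)
    (h : (FDRep.of (matrixRep f)).character = (FDRep.of (matrixRep f')).character)
    (a : MonoidAlgebra ℂ Γ) : (f a).trace = (f' a).trace := by
  induction a using MonoidAlgebra.induction_on with
  | of g => rw [← matrixRep_character, ← matrixRep_character, h]
  | add x y hx hy => simp [Matrix.trace_add, hx, hy]
  | smul r x hx => simp [Matrix.trace_smul, hx]

variable {m : ℕ} {d : Fin m → ℕ}
  (φ : MonoidAlgebra ℂ Γ ≃ₐ[ℂ] Π i, Matrix (Fin (d i)) (Fin (d i)) ℂ)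

/-- The `i`-th block of a Wedderburn decomposition of the group algebra. -/
def wedderburnBlock (i : Fin m) : MonoidAlgebra ℂ Γ →ₐ[ℂ] Matrix (Fin (d i)) (Fin (d i)) ℂ :=
  (Pi.evalAlgHom ℂ (fun i => Matrix (Fin (d i)) (Fin (d i)) ℂ) i).comp φ.toAlgHom

theorem wedderburnBlock_apply (i : Fin m) (a : MonoidAlgebra ℂ Γ) :
    wedderburnBlock φ i a = φ a i := rfl

theorem wedderburnBlock_surjective (i : Fin m) : Function.Surjective (wedderburnBlock φ i) :=
  (Function.surjective_eval i).comp φ.surjective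

/-- The irreducible character afforded by the `i`-th Wedderburn block. -/
def wedderburnChar (i : Fin m) : Γ → ℂ :=
  (FDRep.of (matrixRep (wedderburnBlock φ i))).character

theorem wedderburnChar_one (i : Fin m) : wedderburnChar φ i 1 = d i := by
  simp [wedderburnChar]

theorem wedderburnChar_injective [∀ i, NeZero (d i)] : Function.Injective (wedderburnChar φ) := by
  intro i j hij
  by_contra hne
  have := trace_map_eq_of_character_eq _ _ hij (φ.symm (Pi.single i 1))
  simp [wedderburnBlock_apply, Pi.single_eq_of_ne (Ne.symm hne), NeZero.ne] at this

/-- A class function acts on the `i`-th block by the scalar given by the character sum. -/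
theorem block_ofCoeffs_eq_smul [Fintype Γ] [∀ i, NeZero (d i)] (α : Γ → ℂ)
    (hα : ∀ g x, α (x * g * x⁻¹) = α g) (i : Fin m) :
    φ (ofCoeffs α) i = ((1 / (d i : ℂ)) * ∑ g, α g * wedderburnChar φ i g) • 1 := by
  obtain ⟨c, hc⟩ := exists_eq_smul_one_of_central (φ (ofCoeffs α)) (fun x => by
    obtain ⟨a, rfl⟩ := φ.surjective x
    rw [← map_mul, ofCoeffs_central α hα, map_mul]) i
  have ht := trace_map_ofCoeffs (wedderburnBlock φ i) α
  rw [wedderburnBlock_apply, hc, Matrix.trace_smul, Matrix.trace_one, Fintype.card_fin,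
    smul_eq_mul] at ht
  rw [hc]
  congr 1
  rw [wedderburnChar, ← ht]
  field_simp [NeZero.ne (d i)]

theorem exists_wedderburnChar_eq [Fintype Γ] [∀ i, NeZero (d i)] (V : FDRep ℂ Γ)
    [CategoryTheory.Simple V] :
    ∃ i, wedderburnChar φ i = V.character := by
  by_contra! hne
  have := invertibleOfNonzero (NeZero.ne (Nat.card Γ : ℂ))
  have hsum (i : Fin m) : ∑ g, V.character g⁻¹ * wedderburnChar φ i g = 0 := by
    have := matrixRep_simple _ (wedderburnBlock_surjective φ i)
    have key := FDRep.char_orthonormal (FDRep.of (matrixRep (wedderburnBlock φ i))) V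
    rw [if_neg fun ⟨e⟩ => hne i (FDRep.char_iso e)] at key
    simpa [mul_comm, wedderburnChar] using key
  have hzero : ofCoeffs (fun g : Γ => V.character g⁻¹) = 0 := by
    apply φ.injective
    ext i : 1
    rw [block_ofCoeffs_eq_smul φ _ (fun g x => ?_), hsum]
    · simp
    · rw [← FDRep.char_conj V g⁻¹ x]
      congr 1
      group
  have hV : ∀ g, V.character g = 0 := fun g => by
    rw [← inv_inv g, ← coeff_ofCoeffs (fun g : Γ => V.character g⁻¹), hzero]
    rfl
  have key := (FDRep.simple_iff_char_is_norm_one V).mp inferInstance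
  simp only [hV, mul_zero, Finset.sum_const_zero] at key
  exact NeZero.ne (Nat.card Γ : ℂ) key.symm

end GroupAlgebra

/-- The connection function of the Hermitian adjacency matrix of `Cay(Γ, S)`. -/
def hermitianWeight {Γ : Type} [Group Γ] [DecidableEq Γ] (S : Finset Γ) (g : Γ) : ℂ :=
  if g ∈ S then (if g⁻¹ ∈ S then 1 else Complex.I) else (if g⁻¹ ∈ S then -Complex.I else 0)

theorem hermitianAdjMatrix_eq_transpose {Γ : Type} [Group Γ] [Fintype Γ] [DecidableEq Γ]
    (S : Finset Γ) :
    hermitianAdjMatrix S = (Algebra.leftMulMatrix (MonoidAlgebra.basis Γ ℂ)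
      (ofCoeffs (hermitianWeight S))).transpose := by
  ext a b
  rw [Matrix.transpose_apply, leftMulMatrix_ofCoeffs]
  simp [hermitianAdjMatrix, hermitianWeight]

theorem hermitianWeight_conj {Γ : Type} [Group Γ] [DecidableEq Γ] (S : Finset Γ)
    (hS : ∀ s ∈ S, ∀ x : Γ, x * s * x⁻¹ ∈ S) (g x : Γ) :
    hermitianWeight S (x * g * x⁻¹) = hermitianWeight S g := by
  have hmem (g : Γ) : x * g * x⁻¹ ∈ S ↔ g ∈ S :=
    ⟨fun h => by simpa [mul_assoc] using hS _ h x⁻¹, fun h => hS g h x⟩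
  have hinv : (x * g * x⁻¹)⁻¹ = x * g⁻¹ * x⁻¹ := by group
  simp only [hermitianWeight, hinv, hmem]

theorem sum_hermitianWeight_mul {Γ : Type} [Group Γ] [Fintype Γ] [DecidableEq Γ] (S : Finset Γ)
    (ψ : Γ → ℂ) :
    ∑ g, hermitianWeight S g * ψ g =
      ∑ s ∈ S \ S.filter (fun s => s⁻¹ ∉ S), ψ s +
        Complex.I * ∑ s ∈ S.filter (fun s => s⁻¹ ∉ S), (ψ s - ψ s⁻¹) := by
  have hinv : ∑ s ∈ S.filter (fun s => s⁻¹ ∉ S), ψ s⁻¹ =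
      ∑ g, if g⁻¹ ∈ S ∧ g ∉ S then ψ g else 0 := by
    rw [← Equiv.sum_comp (Equiv.inv Γ)]
    simp only [Equiv.inv_apply, inv_inv, ← Finset.sum_filter]
    exact Finset.sum_congr (by ext; simp) fun _ _ => rfl
  have hself : ∑ s ∈ S.filter (fun s => s⁻¹ ∉ S), ψ s =
      ∑ g, if g ∈ S ∧ g⁻¹ ∉ S then ψ g else 0 := by
    rw [← Finset.sum_filter]
    exact Finset.sum_congr (by ext; simp) fun _ _ => rfl
  have hsymm : ∑ s ∈ S \ S.filter (fun s => s⁻¹ ∉ S), ψ s =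
      ∑ g, if g ∈ S ∧ g⁻¹ ∈ S then ψ g else 0 := by
    rw [← Finset.sum_filter]
    exact Finset.sum_congr (by ext; simp +contextual) fun _ _ => rfl
  rw [Finset.sum_sub_distrib, hinv, hself, hsymm, ← Finset.sum_sub_distrib, Finset.mul_sum,
    ← Finset.sum_add_distrib]
  refine Finset.sum_congr rfl fun g _ => ?_
  by_cases h₁ : g ∈ S <;> by_cases h₂ : g⁻¹ ∈ S <;> simp [hermitianWeight, h₁, h₂]

/-- The H-spectrum of a normal mixed Cayley graph `Cay(Γ, S)` is
`{[γ_1]^{d_1²}, …, [γ_h]^{d_h²}}` where `γ_j = λ_j + μ_j`,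
`λ_j = (1/χ_j(1)) Σ_{s ∈ S∖S̄} χ_j(s)` and
`μ_j = (i/χ_j(1)) Σ_{s ∈ S̄} (χ_j(s) − χ_j(s⁻¹))`. -/
theorem normal_mixed_cayley_charpoly
    (Γ : Type) [Group Γ] [Fintype Γ] [DecidableEq Γ]
    (S : Finset Γ) (hS1 : (1 : Γ) ∉ S)
    (hnormal : ∀ s ∈ S, ∀ x : Γ, x * s * x⁻¹ ∈ S)
    (h : ℕ) (χ : Fin h → Γ → ℂ)
    (hirr : ∀ j, ∃ V : FDRep ℂ Γ, CategoryTheory.Simple V ∧ χ j = V.character)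
    (hdistinct : Function.Injective χ)
    (hcomplete : ∀ V : FDRep ℂ Γ, CategoryTheory.Simple V → ∃ j, χ j = V.character)
    (d : Fin h → ℕ) (hd : ∀ j, χ j 1 = d j) :
    (hermitianAdjMatrix S).charpoly
      = ∏ j : Fin h,
          (Polynomial.X - Polynomial.C
            ((1 / χ j 1) * ∑ s ∈ S \ S.filter (fun s => s⁻¹ ∉ S), χ j s
              + (Complex.I / χ j 1) *
                  ∑ s ∈ S.filter (fun s => s⁻¹ ∉ S), (χ j s - χ j s⁻¹))) ^ (d j) ^ 2 := by
  obtain ⟨m, n, hn, ⟨φ⟩⟩ :=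
    IsSemisimpleRing.exists_algEquiv_pi_matrix_of_isAlgClosed ℂ (MonoidAlgebra ℂ Γ)
  have hex (j : Fin h) : ∃ i, wedderburnChar φ i = χ j := by
    obtain ⟨V, hV, hχ⟩ := hirr j
    rw [hχ]
    exact exists_wedderburnChar_eq φ V
  choose e he using hex
  have he_bij : Function.Bijective e := by
    refine ⟨fun j k hjk => hdistinct (by rw [← he, hjk, he]), fun i => ?_⟩
    obtain ⟨j, hj⟩ := hcomplete _ (matrixRep_simple _ (wedderburnBlock_surjective φ i))
    exact ⟨j, wedderburnChar_injective φ ((he j).trans hj)⟩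
  have hconj : Algebra.lmul ℂ _ (φ (ofCoeffs (hermitianWeight S))) =
      φ.toLinearEquiv.conj (Algebra.lmul ℂ _ (ofCoeffs (hermitianWeight S))) := by
    refine LinearMap.ext fun x => ?_
    simp [LinearEquiv.conj_apply]
  rw [hermitianAdjMatrix_eq_transpose, Matrix.charpoly_transpose, Algebra.leftMulMatrix_apply,
    LinearMap.charpoly_toMatrix, ← φ.toLinearEquiv.charpoly_conj, ← hconj,
    charpoly_lmul_pi_matrix _ _
      (block_ofCoeffs_eq_smul φ _ (hermitianWeight_conj S hnormal))]
  symm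
  refine Fintype.prod_bijective e he_bij _ _ fun j => ?_
  have hone : χ j 1 = n (e j) := by rw [← he, wedderburnChar_one]
  have hdim : d j = n (e j) := by exact_mod_cast (hd j).symm.trans hone
  rw [he, sum_hermitianWeight_mul, hdim, hone]
  congr 3
  ring
end
end

section
/- Let Γ be a finite group, S ⊆ Γ with 1 ∉ S, S symmetric (closed under inverses), and S a union of conjugacy classes of Γ (so Cay(Γ,S) is a normal simple Cayley graph). Let Irr(Γ) = {χ_1, …, χ_h}. Then the characteristic polynomial of the Hermitian adjacency matrix H of Cay(Γ,S) (which here coincides with the (0,1)-adjacency matrix) equals ∏_{j=1}^{h} (X − λ_j)^{χ_j(1)²}, where λ_j = (1/χ_j(1)) · Σ_{s ∈ S} χ_j(s). -/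
open scoped Classical

noncomputable section

namespace Representation

variable {k G V W : Type*} [Field k] [Group G]
  [AddCommGroup V] [Module k V] [AddCommGroup W] [Module k W]

/-- An irreducible representation acts on a conjugation-invariant sum by a scalar, so the
characteristic polynomial of that sum is a power of a linear polynomial. -/
theorem charpoly_sum_of_isIrreducible [IsAlgClosed k] [CharZero k] [FiniteDimensional k V]
    (ρ : Representation k G V) [IsIrreducible ρ] (S : Finset G)
    (hS : ∀ s ∈ S, ∀ x : G, x * s * x⁻¹ ∈ S) :
    (∑ s ∈ S, ρ s).charpoly =
      (Polynomial.X - Polynomial.C ((1 / ρ.character 1) * ∑ s ∈ S, ρ.character s)) ^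
        Module.finrank k V := by
  have hcomm (g : G) : (∑ s ∈ S, ρ s) ∘ₗ ρ g = ρ g ∘ₗ ∑ s ∈ S, ρ s := by
    change (∑ s ∈ S, ρ s) * ρ g = ρ g * ∑ s ∈ S, ρ s
    rw [Finset.sum_mul, Finset.mul_sum]
    refine Finset.sum_bij' (fun s _ => g⁻¹ * s * g) (fun s _ => g * s * g⁻¹)
      (fun s hs => by simpa using hS s hs g⁻¹) (fun s hs => hS s hs g)
      (fun s _ => by group) (fun s _ => by group) (fun s _ => ?_)
    rw [← map_mul, ← map_mul]
    congr 1
    group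
  let f : IntertwiningMap ρ ρ := ⟨∑ s ∈ S, ρ s, hcomm⟩
  obtain ⟨c, hc⟩ := (IsIrreducible.algebraMap_intertwiningMap_bijective_of_isAlgClosed (ρ := ρ)).2 f
  have hsum : ∑ s ∈ S, ρ s = c • (1 : Module.End k V) := by
    ext v
    exact (DFunLike.congr_fun hc v).symm
  have : Nontrivial V := by
    by_contra hV
    rw [not_nontrivial_iff_subsingleton] at hV
    have : (⊥ : Subrepresentation ρ) = ⊤ :=
      Subrepresentation.toSubmodule_injective (Subsingleton.elim _ _)
    exact bot_ne_top this
  have hdim : (Module.finrank k V : k) ≠ 0 := Nat.cast_ne_zero.mpr Module.finrank_pos.ne'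
  have htrace : ∑ s ∈ S, ρ.character s = c * Module.finrank k V := by
    have := congrArg (LinearMap.trace k V) hsum
    simpa [character] using this
  have hcp := LinearMap.charpoly_sub_smul (0 : Module.End k V) (-c)
  rw [zero_sub, neg_smul, neg_neg] at hcp
  rw [htrace, char_one, hsum, hcp, LinearMap.charpoly_zero]
  simp only [Polynomial.pow_comp, Polynomial.X_comp, map_neg]
  congr 1
  rw [sub_eq_add_neg]
  congr 3
  field_simp

theorem character_prod [FiniteDimensional k V] [FiniteDimensional k W]
    (ρ : Representation k G V) (σ : Representation k G W) (g : G) :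
    (ρ.prod σ).character g = ρ.character g + σ.character g :=
  LinearMap.trace_prodMap' (ρ g) (σ g)

theorem charpoly_sum_prod [FiniteDimensional k V] [FiniteDimensional k W]
    (ρ : Representation k G V) (σ : Representation k G W) (S : Finset G) :
    (∑ s ∈ S, ρ.prod σ s).charpoly = (∑ s ∈ S, ρ s).charpoly * (∑ s ∈ S, σ s).charpoly := by
  rw [← LinearMap.charpoly_prodMap]
  congr 1
  ext <;> simp [LinearMap.sum_apply, prod, Prod.fst_sum, Prod.snd_sum]

theorem charpoly_sum_congr [FiniteDimensional k V] [FiniteDimensional k W]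
    {ρ : Representation k G V} {σ : Representation k G W} (e : Equiv ρ σ) (S : Finset G) :
    (∑ s ∈ S, ρ s).charpoly = (∑ s ∈ S, σ s).charpoly := by
  rw [← LinearEquiv.charpoly_conj e.toLinearEquiv, map_sum]
  congr 1
  exact Finset.sum_congr rfl fun s _ => e.conj_apply_self s

/-- A representation is the direct sum of two complementary subrepresentations. -/
def prodEquivOfIsCompl {ρ : Representation k G V} (p q : Subrepresentation ρ) (h : IsCompl p q) :
    Equiv (p.toRepresentation.prod q.toRepresentation) ρ :=
  .mk (Submodule.prodEquivOfIsCompl p.toSubmodule q.toSubmodule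
    (IsCompl.of_eq (congrArg Subrepresentation.toSubmodule h.inf_eq_bot)
      (congrArg Subrepresentation.toSubmodule h.sup_eq_top)))
    fun g => by
      ext <;> simp [prod, Subrepresentation.toRepresentation]

end Representation

/-- The left regular representation on functions. -/
def regularRepresentation (Γ : Type) [Group Γ] : Representation ℂ Γ (Γ → ℂ) where
  toFun g := LinearMap.funLeft ℂ ℂ (g⁻¹ * ·)
  map_one' := by ext; simp [LinearMap.funLeft]
  map_mul' g h := by ext; simp [LinearMap.funLeft, mul_assoc]

theorem character_regularRepresentation (Γ : Type) [Group Γ] [Fintype Γ] [DecidableEq Γ] (g : Γ) :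
    (regularRepresentation Γ).character g = if g = 1 then (Fintype.card Γ : ℂ) else 0 := by
  rw [Representation.character, LinearMap.trace_eq_matrix_trace ℂ (Pi.basisFun ℂ Γ)]
  simp [Matrix.trace, regularRepresentation, LinearMap.funLeft, Pi.single_apply]

theorem charpoly_hermitianAdjMatrix {Γ : Type} [Group Γ] [Fintype Γ] [DecidableEq Γ]
    (S : Finset Γ) (hsym : ∀ s ∈ S, s⁻¹ ∈ S) :
    (hermitianAdjMatrix S).charpoly = (∑ s ∈ S, regularRepresentation Γ s).charpoly := by
  rw [← LinearMap.charpoly_toMatrix _ (Pi.basisFun ℂ Γ)]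
  congr 1
  ext a b
  have hba : b * a⁻¹ ∈ S ↔ a * b⁻¹ ∈ S :=
    ⟨fun h => by simpa using hsym _ h, fun h => by simpa using hsym _ h⟩
  have (s : Γ) : s⁻¹ * a = b ↔ a * b⁻¹ = s := by
    rw [inv_mul_eq_iff_eq_mul, mul_inv_eq_iff_eq_mul]
  simp [hermitianAdjMatrix, hba, regularRepresentation, LinearMap.funLeft,
    Pi.single_apply, this]
  split_ifs <;> rfl

theorem FDRep.simple_of_isIrreducible {Γ : Type} [Group Γ] [Fintype Γ]
    {V : Type} [AddCommGroup V] [Module ℂ V] [FiniteDimensional ℂ V]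
    (ρ : Representation ℂ Γ V) [ρ.IsIrreducible] : CategoryTheory.Simple (FDRep.of ρ) := by
  have := invertibleOfNonzero (NeZero.ne (Nat.card Γ : ℂ))
  rw [FDRep.simple_iff_char_is_norm_one]
  have horth := Representation.char_orthonormal ρ ρ
  rw [if_pos ⟨.refl ρ⟩, inv_mul_eq_one₀ (NeZero.ne _)] at horth
  exact horth.symm

theorem exists_character_eq_sum_and_charpoly_eq_prod
    {Γ : Type} [Group Γ] [Fintype Γ]
    (S : Finset Γ) (hnormal : ∀ s ∈ S, ∀ x : Γ, x * s * x⁻¹ ∈ S)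
    {h : ℕ} (χ : Fin h → Γ → ℂ)
    (hcomplete : ∀ V : FDRep ℂ Γ, CategoryTheory.Simple V → ∃ j, χ j = V.character)
    (d : Fin h → ℕ) (hd : ∀ j, χ j 1 = d j)
    {V : Type} [AddCommGroup V] [Module ℂ V] [FiniteDimensional ℂ V]
    (ρ : Representation ℂ Γ V) :
    ∃ m : Fin h → ℕ, (∀ g, ρ.character g = ∑ j, m j * χ j g) ∧
      (∑ s ∈ S, ρ s).charpoly = ∏ j,
        (Polynomial.X - Polynomial.C ((1 / χ j 1) * ∑ s ∈ S, χ j s)) ^ (m j * d j) := by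
  induction hn : Module.finrank ℂ V using Nat.strong_induction_on generalizing V with
  | _ n ih =>
  rcases subsingleton_or_nontrivial V with hV | hV
  · refine ⟨0, fun g => ?_, ?_⟩
    · simp [Representation.character, Subsingleton.elim (ρ g) 0]
    · simp [Subsingleton.elim (∑ s ∈ S, ρ s) 0, LinearMap.charpoly_zero,
        Module.finrank_zero_of_subsingleton]
  by_cases hirr : ρ.IsIrreducible
  · obtain ⟨j, hj⟩ := hcomplete _ (FDRep.simple_of_isIrreducible ρ)
    have hj : χ j = ρ.character := hj
    refine ⟨Pi.single j 1, fun g => ?_, ?_⟩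
    · simp [Pi.single_apply, hj]
    · have hdj : d j = Module.finrank ℂ V := by
        have := hd j
        rw [hj, Representation.char_one] at this
        exact_mod_cast this.symm
      rw [Representation.charpoly_sum_of_isIrreducible ρ S hnormal, Finset.prod_eq_single j]
      · simp [hj, hdj]
      · intro i _ hij
        simp [hij]
      · simp
  · have : ∃ p : Subrepresentation ρ, p ≠ ⊥ ∧ p ≠ ⊤ := by
      by_contra! hp
      refine hirr { exists_pair_ne := ⟨⊥, ⊤, fun hbt => ?_⟩,
                    eq_bot_or_eq_top := fun p => or_iff_not_imp_left.mpr (hp p) }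
      exact bot_ne_top (α := Submodule ℂ V) (congrArg Subrepresentation.toSubmodule hbt)
    obtain ⟨p, hp_bot, hp_top⟩ := this
    obtain ⟨q, hpq⟩ := exists_isCompl p
    have hlt (r : Subrepresentation ρ) (hr : r ≠ ⊤) : Module.finrank ℂ r.toSubmodule < n :=
      hn ▸ Submodule.finrank_lt fun hr' => hr (Subrepresentation.toSubmodule_injective hr')
    have hq_top : q ≠ ⊤ := fun hq => hp_bot (by simpa [hq] using hpq.inf_eq_bot)
    obtain ⟨m₁, hm₁, hc₁⟩ := ih _ (hlt p hp_top) p.toRepresentation rfl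
    obtain ⟨m₂, hm₂, hc₂⟩ := ih _ (hlt q hq_top) q.toRepresentation rfl
    have e := Representation.prodEquivOfIsCompl p q hpq
    refine ⟨m₁ + m₂, fun g => ?_, ?_⟩
    · rw [← Representation.char_iso e, Representation.character_prod, hm₁, hm₂]
      simp [add_mul, Finset.sum_add_distrib]
    · rw [← Representation.charpoly_sum_congr e, Representation.charpoly_sum_prod, hc₁, hc₂,
        ← Finset.prod_mul_distrib]
      simp [add_mul, pow_add]

/-- The spectrum of a normal simple Cayley graph `Cay(Γ, S)` (with `S` symmetric) is
`{[λ_1]^{d_1²}, …, [λ_h]^{d_h²}}` where `λ_j = (1/χ_j(1)) Σ_{s ∈ S} χ_j(s)`. -/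
theorem normal_simple_cayley_charpoly
    (Γ : Type) [Group Γ] [Fintype Γ] [DecidableEq Γ]
    (S : Finset Γ) (hS1 : (1 : Γ) ∉ S)
    (hsym : ∀ s ∈ S, s⁻¹ ∈ S)
    (hnormal : ∀ s ∈ S, ∀ x : Γ, x * s * x⁻¹ ∈ S)
    (h : ℕ) (χ : Fin h → Γ → ℂ)
    (hirr : ∀ j, ∃ V : FDRep ℂ Γ, CategoryTheory.Simple V ∧ χ j = V.character)
    (hdistinct : Function.Injective χ)
    (hcomplete : ∀ V : FDRep ℂ Γ, CategoryTheory.Simple V → ∃ j, χ j = V.character)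
    (d : Fin h → ℕ) (hd : ∀ j, χ j 1 = d j) :
    (hermitianAdjMatrix S).charpoly
      = ∏ j : Fin h,
          (Polynomial.X - Polynomial.C ((1 / χ j 1) * ∑ s ∈ S, χ j s)) ^ (d j) ^ 2 := by
  obtain ⟨m, hm, hcp⟩ := exists_character_eq_sum_and_charpoly_eq_prod S hnormal χ hcomplete d hd
    (regularRepresentation Γ)
  have hcard : (Nat.card Γ : ℂ) ≠ 0 := NeZero.ne _
  have := invertibleOfNonzero hcard
  have horth (i j : Fin h) :
      (Nat.card Γ : ℂ)⁻¹ * ∑ g : Γ, χ i g * χ j g⁻¹ = if i = j then 1 else 0 := by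
    obtain ⟨V, hV, hi⟩ := hirr i
    obtain ⟨W, hW, hj⟩ := hirr j
    rw [hi, hj, FDRep.char_orthonormal V W]
    refine if_congr ⟨fun ⟨e⟩ => hdistinct ?_, fun hij => ?_⟩ rfl rfl
    · rw [hi, hj, FDRep.char_iso e]
    · by_contra hne
      have h1 := FDRep.char_orthonormal V W
      have h2 := FDRep.char_orthonormal V V
      rw [if_neg hne, ← hj, ← hij, hi] at h1
      rw [if_pos ⟨CategoryTheory.Iso.refl V⟩, h1] at h2
      exact zero_ne_one h2
  have hmd (j : Fin h) : m j = d j := by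
    have h1 : (Nat.card Γ : ℂ)⁻¹ * ∑ g : Γ, (regularRepresentation Γ).character g * χ j g⁻¹
        = d j := by
      simp [character_regularRepresentation, hd]
    have h2 : (Nat.card Γ : ℂ)⁻¹ * ∑ g : Γ, (regularRepresentation Γ).character g * χ j g⁻¹
        = m j := by
      calc _ = ∑ i, (m i : ℂ) * ((Nat.card Γ : ℂ)⁻¹ * ∑ g : Γ, χ i g * χ j g⁻¹) := by
            simp_rw [hm, Finset.sum_mul, Finset.mul_sum]
            rw [Finset.sum_comm]
            refine Finset.sum_congr rfl fun i _ => Finset.sum_congr rfl fun g _ => by ring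
        _ = m j := by simp_rw [horth]; simp
    exact_mod_cast h2.symm.trans h1
  rw [charpoly_hermitianAdjMatrix S hsym, hcp]
  simp [hmd, sq]
end
end

section
/- Let Γ be a finite group, S ⊆ Γ with 1 ∉ S, S skew-symmetric (s ∈ S implies s⁻¹ ∉ S), and S a union of conjugacy classes of Γ (so Cay(Γ,S) is a normal oriented Cayley graph). Let Irr(Γ) = {χ_1, …, χ_h}. Then the characteristic polynomial of the Hermitian adjacency matrix H of Cay(Γ,S) equals ∏_{j=1}^{h} (X − μ_j)^{χ_j(1)²}, where μ_j = (i/χ_j(1)) · Σ_{s ∈ S} (χ_j(s) − χ_j(s⁻¹)). -/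
open scoped Classical

noncomputable section

section CharpolyHelpers

variable {K V : Type*} [Field K] [AddCommGroup V] [Module K V]

/-- An endomorphism preserving two complementary subspaces is conjugate to the product of its
restrictions. -/
lemma LinearMap.prodMap_restrict_eq_conj_of_isCompl {W₁ W₂ : Submodule K V} (hW : IsCompl W₁ W₂)
    (φ : V →ₗ[K] V) (h₁ : ∀ x ∈ W₁, φ x ∈ W₁) (h₂ : ∀ x ∈ W₂, φ x ∈ W₂) :
    (φ.restrict h₁).prodMap (φ.restrict h₂)
      = (Submodule.prodEquivOfIsCompl W₁ W₂ hW).symm.conj φ := by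
  refine LinearMap.ext fun x => ?_
  rw [LinearEquiv.conj_apply_apply, LinearEquiv.eq_symm_apply]
  simp [Submodule.coe_prodEquivOfIsCompl']

variable [FiniteDimensional K V]

lemma LinearMap.charpoly_eq_mul_restrict_of_isCompl {W₁ W₂ : Submodule K V} (hW : IsCompl W₁ W₂)
    (φ : V →ₗ[K] V) (h₁ : ∀ x ∈ W₁, φ x ∈ W₁) (h₂ : ∀ x ∈ W₂, φ x ∈ W₂) :
    φ.charpoly = (φ.restrict h₁).charpoly * (φ.restrict h₂).charpoly := by
  rw [← LinearMap.charpoly_prodMap, LinearMap.prodMap_restrict_eq_conj_of_isCompl hW,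
    LinearEquiv.charpoly_conj]

lemma LinearMap.trace_eq_add_restrict_of_isCompl {W₁ W₂ : Submodule K V} (hW : IsCompl W₁ W₂)
    (φ : V →ₗ[K] V) (h₁ : ∀ x ∈ W₁, φ x ∈ W₁) (h₂ : ∀ x ∈ W₂, φ x ∈ W₂) :
    LinearMap.trace K V φ
      = LinearMap.trace K W₁ (φ.restrict h₁) + LinearMap.trace K W₂ (φ.restrict h₂) := by
  rw [← LinearMap.trace_prodMap', LinearMap.prodMap_restrict_eq_conj_of_isCompl hW,
    LinearMap.trace_conj']

lemma LinearMap.charpoly_smul_id (c : K) :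
    (c • (LinearMap.id : V →ₗ[K] V)).charpoly
      = (Polynomial.X - Polynomial.C c) ^ Module.finrank K V := by
  have h := LinearMap.charpoly_sub_smul (0 : Module.End K V) (-c)
  rw [LinearMap.charpoly_zero] at h
  have e : (c • (LinearMap.id : V →ₗ[K] V)) = (0 : Module.End K V) - (-c) • 1 := by
    ext; simp
  rw [e, h]
  simp [sub_eq_add_neg]

end CharpolyHelpers

namespace Representation

section

variable {k G V : Type*} [Field k] [Group G] [Fintype G] [AddCommGroup V] [Module k V]

/-- The action on a representation `ρ` of the group algebra element with coefficients `f`. -/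
def weightedSum (ρ : Representation k G V) (f : G → k) : V →ₗ[k] V :=
  ∑ g, f g • ρ g

lemma weightedSum_comm (ρ : Representation k G V) {f : G → k}
    (hf : ∀ g x, f (x * g * x⁻¹) = f g) (x : G) (v : V) :
    ρ.weightedSum f (ρ x v) = ρ x (ρ.weightedSum f v) := by
  simp only [weightedSum, LinearMap.sum_apply, LinearMap.smul_apply, map_sum, map_smul,
    ← Module.End.mul_apply, ← map_mul]
  refine Fintype.sum_equiv (MulAut.conj x⁻¹).toEquiv _ _ fun g => ?_
  have h := hf g x⁻¹
  simp_all [mul_assoc]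

lemma restrict_weightedSum {ρ : Representation k G V} (W : Subrepresentation ρ) (f : G → k)
    (h : ∀ x ∈ W.toSubmodule, ρ.weightedSum f x ∈ W.toSubmodule) :
    (ρ.weightedSum f).restrict h = W.toRepresentation.weightedSum f := by
  ext x
  simp [weightedSum, Subrepresentation.toRepresentation]

lemma weightedSum_mem {ρ : Representation k G V} (W : Subrepresentation ρ) (f : G → k) :
    ∀ x ∈ W.toSubmodule, ρ.weightedSum f x ∈ W.toSubmodule := fun x hx => by
  simpa [weightedSum] using
    W.toSubmodule.sum_mem fun g _ => W.toSubmodule.smul_mem (f g) (W.apply_mem_toSubmodule g hx)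

variable [FiniteDimensional k V]

/-- A class function acts on an irreducible representation by the scalar given by its pairing with
the character. -/
lemma weightedSum_eq_smul_id [CharZero k] [IsAlgClosed k] (ρ : Representation k G V)
    [IsIrreducible ρ] {f : G → k} (hf : ∀ g x, f (x * g * x⁻¹) = f g) :
    ρ.weightedSum f = ((∑ g, f g * ρ.character g) / ρ.character 1) • LinearMap.id := by
  obtain ⟨c, hc⟩ := (IsIrreducible.algebraMap_intertwiningMap_bijective_of_isAlgClosed
    (ρ := ρ)).2 ((ρ.weightedSum f).intertwiningMap_of_isIntertwiningMap ρ ρ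
      (ρ.weightedSum_comm hf))
  have hT : ρ.weightedSum f = c • LinearMap.id :=
    (congrArg IntertwiningMap.toLinearMap hc).symm
  have htr := congrArg (LinearMap.trace k V) hT
  have : Nontrivial V := by
    by_contra h
    rw [not_nontrivial_iff_subsingleton] at h
    obtain ⟨a, b, hab⟩ := (inferInstance : Nontrivial (Subrepresentation ρ))
    exact hab (Subrepresentation.toSubmodule_injective (Subsingleton.elim _ _))
  have hd : (Module.finrank k V : k) ≠ 0 := Nat.cast_ne_zero.mpr Module.finrank_pos.ne'
  have hsum : ∑ g, f g * ρ.character g = c * Module.finrank k V := by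
    simpa [weightedSum, character] using htr
  rw [hsum, char_one, mul_div_cancel_right₀ _ hd, hT]

end

/-- An irreducible complex representation of a finite group is simple in `FDRep`. -/
lemma IsIrreducible.simple_fdRep {G V : Type} [Group G] [Fintype G] [AddCommGroup V] [Module ℂ V]
    [FiniteDimensional ℂ V] (ρ : Representation ℂ G V) [IsIrreducible ρ] :
    CategoryTheory.Simple (FDRep.of ρ) := by
  rw [FDRep.simple_iff_char_is_norm_one]
  have hne : (Nat.card G : ℂ) ≠ 0 := NeZero.ne _
  have := invertibleOfNonzero hne
  have h := char_orthonormal ρ ρ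
  rw [if_pos ⟨Equiv.refl ρ⟩] at h
  change ∑ g, ρ.character g * ρ.character g⁻¹ = _
  field_simp at h
  exact h

/-- Every complex representation of a finite group decomposes into irreducible ones; recorded at
the level of characters and of characteristic polynomials of class functions. -/
lemma exists_multiplicities {G : Type} [Group G] [Fintype G] {ι : Type} [Fintype ι]
    (χ : ι → G → ℂ)
    (hcomplete : ∀ V : FDRep ℂ G, CategoryTheory.Simple V → ∃ j, χ j = V.character)
    (d : ι → ℕ) (hd : ∀ j, χ j 1 = d j) {f : G → ℂ} (hf : ∀ g x, f (x * g * x⁻¹) = f g)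
    (N : ℕ) : ∀ (V : Type) [AddCommGroup V] [Module ℂ V] [FiniteDimensional ℂ V]
      (ρ : Representation ℂ G V), Module.finrank ℂ V = N → ∃ n : ι → ℕ,
        (∀ g, ρ.character g = ∑ j, n j * χ j g) ∧
        (ρ.weightedSum f).charpoly
          = ∏ j, (Polynomial.X - Polynomial.C ((∑ g, f g * χ j g) / χ j 1)) ^ (n j * d j) := by
  induction N using Nat.strong_induction_on with
  | _ N ih =>
  intro V _ _ _ ρ hN
  by_cases htriv : Subsingleton V
  · refine ⟨0, fun g => ?_, ?_⟩
    · simp [character, Subsingleton.elim (ρ g) 0]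
    · rw [Subsingleton.elim (ρ.weightedSum f) 0, LinearMap.charpoly_zero,
        Module.finrank_zero_of_subsingleton]
      simp
  by_cases hirr : IsIrreducible ρ
  · obtain ⟨j, hj⟩ := hcomplete _ (IsIrreducible.simple_fdRep ρ)
    replace hj : χ j = ρ.character := hj
    have hdj : d j = Module.finrank ℂ V := by
      have := hd j
      rw [hj, char_one] at this
      exact_mod_cast this.symm
    refine ⟨Pi.single j 1, fun g => ?_, ?_⟩
    · rw [Finset.sum_eq_single j]
      · simp [hj]
      · intro i _ hi
        simp [Pi.single_eq_of_ne hi]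
      · simp
    · rw [weightedSum_eq_smul_id ρ hf, LinearMap.charpoly_smul_id, Finset.prod_eq_single j]
      · simp [hj, hdj]
      · intro i _ hi
        simp [Pi.single_eq_of_ne hi]
      · simp
  · have hnt : Nontrivial (Subrepresentation ρ) := by
      rw [not_subsingleton_iff_nontrivial] at htriv
      refine ⟨⊥, ⊤, fun h => ?_⟩
      exact bot_ne_top (α := Submodule ℂ V) (congrArg Subrepresentation.toSubmodule h)
    obtain ⟨W, hbot, htop⟩ : ∃ W : Subrepresentation ρ, W ≠ ⊥ ∧ W ≠ ⊤ := by
      by_contra! h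
      exact hirr ⟨fun W => or_iff_not_imp_left.mpr (h W)⟩
    obtain ⟨W', hW⟩ := exists_isCompl W
    have hc : IsCompl W.toSubmodule W'.toSubmodule := by
      refine IsCompl.of_eq ?_ ?_
      · exact congrArg Subrepresentation.toSubmodule hW.inf_eq_bot
      · exact congrArg Subrepresentation.toSubmodule hW.sup_eq_top
    have hlt : Module.finrank ℂ W.toSubmodule < N := by
      rw [← hN]
      exact Submodule.finrank_lt fun h => htop (Subrepresentation.toSubmodule_injective h)
    have hlt' : Module.finrank ℂ W'.toSubmodule < N := by
      rw [← hN]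
      refine Submodule.finrank_lt fun h => hbot (Subrepresentation.toSubmodule_injective ?_)
      have := hc.inf_eq_bot
      rwa [h, inf_top_eq] at this
    obtain ⟨n, hn, hn'⟩ := ih _ hlt _ W.toRepresentation rfl
    obtain ⟨m, hm, hm'⟩ := ih _ hlt' _ W'.toRepresentation rfl
    refine ⟨n + m, fun g => ?_, ?_⟩
    · have h : ρ.character g = W.toRepresentation.character g + W'.toRepresentation.character g :=
        LinearMap.trace_eq_add_restrict_of_isCompl hc (ρ g) (W.apply_mem_toSubmodule g)
          (W'.apply_mem_toSubmodule g)
      rw [h, hn, hm, ← Finset.sum_add_distrib]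
      exact Finset.sum_congr rfl fun j _ => by simp [add_mul]
    · rw [LinearMap.charpoly_eq_mul_restrict_of_isCompl hc _ (weightedSum_mem W f)
        (weightedSum_mem W' f), restrict_weightedSum, restrict_weightedSum, hn', hm',
        ← Finset.prod_mul_distrib]
      exact Finset.prod_congr rfl fun j _ => by simp [add_mul, pow_add]

/-- The left regular representation on functions. -/
def regularOnFunctions (k G : Type*) [Field k] [Group G] : Representation k G (G → k) where
  toFun g := LinearMap.funLeft k k fun a => g⁻¹ * a
  map_one' := by ext; simp [LinearMap.funLeft]
  map_mul' x y := by
    refine LinearMap.ext fun v => funext fun a => ?_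
    simp [LinearMap.funLeft, mul_assoc]

lemma regularOnFunctions_apply {k G : Type*} [Field k] [Group G] (g : G) (v : G → k) (a : G) :
    regularOnFunctions k G g v a = v (g⁻¹ * a) := rfl

lemma character_regularOnFunctions {k G : Type*} [Field k] [Group G] [Fintype G] (g : G) :
    (regularOnFunctions k G).character g = if g = 1 then (Fintype.card G : k) else 0 := by
  rw [character, LinearMap.trace_eq_matrix_trace k (Pi.basisFun k G), Matrix.trace]
  simp only [Matrix.diag_apply, LinearMap.toMatrix_apply, Pi.basisFun_apply, Pi.basisFun_repr,
    regularOnFunctions_apply, Pi.single_apply]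
  by_cases hg : g = 1 <;> simp [hg]

/-- Each irreducible character occurs in the regular representation as often as its degree. -/
lemma multiplicity_eq_degree {G : Type} [Group G] [Fintype G] {ι : Type} [Fintype ι]
    (χ : ι → G → ℂ)
    (hirr : ∀ j, ∃ V : FDRep ℂ G, CategoryTheory.Simple V ∧ χ j = V.character)
    (hdistinct : Function.Injective χ) (n : ι → ℕ)
    (hn : ∀ g, (regularOnFunctions ℂ G).character g = ∑ j, n j * χ j g) (j : ι) :
    (n j : ℂ) = χ j 1 := by
  have hne : (Nat.card G : ℂ) ≠ 0 := NeZero.ne _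
  have := invertibleOfNonzero hne
  have horth : ∀ i, (Nat.card G : ℂ)⁻¹ * ∑ g, χ i g * χ j g⁻¹ = if i = j then 1 else 0 := by
    intro i
    obtain ⟨V, _, hV⟩ := hirr i
    obtain ⟨W, _, hW⟩ := hirr j
    rw [hV, hW, FDRep.char_orthonormal V W]
    refine if_congr ⟨fun ⟨e⟩ => hdistinct ?_, fun h => ?_⟩ rfl rfl
    · rw [hV, hW, FDRep.char_iso e]
    · subst h
      by_contra hVW
      have h₁ := FDRep.char_orthonormal V W
      have h₂ := FDRep.char_orthonormal V V
      rw [if_neg hVW, ← hW, hV] at h₁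
      rw [if_pos ⟨CategoryTheory.Iso.refl V⟩, h₁] at h₂
      exact zero_ne_one h₂
  have h₁ : (Nat.card G : ℂ)⁻¹ * ∑ g, (regularOnFunctions ℂ G).character g * χ j g⁻¹ = χ j 1 := by
    simp only [character_regularOnFunctions, ite_mul, zero_mul, Finset.sum_ite_eq',
      Finset.mem_univ, if_true, inv_one, ← Nat.card_eq_fintype_card]
    rw [inv_mul_cancel_left₀ hne]
  rw [← h₁]
  simp only [hn, Finset.sum_mul, mul_assoc]
  rw [Finset.sum_comm]
  simp only [← Finset.mul_sum]
  rw [Finset.mul_sum]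
  simp only [mul_left_comm _ (n _ : ℂ), horth]
  simp

end Representation

/-- The H-spectrum of a normal oriented Cayley graph `Cay(Γ, S)` (with `S` skew-symmetric) is
`{[μ_1]^{d_1²}, …, [μ_h]^{d_h²}}` where `μ_j = (i/χ_j(1)) Σ_{s ∈ S} (χ_j(s) − χ_j(s⁻¹))`. -/
theorem normal_oriented_cayley_charpoly
    (Γ : Type) [Group Γ] [Fintype Γ] [DecidableEq Γ]
    (S : Finset Γ) (hS1 : (1 : Γ) ∉ S)
    (hskew : ∀ s ∈ S, s⁻¹ ∉ S)
    (hnormal : ∀ s ∈ S, ∀ x : Γ, x * s * x⁻¹ ∈ S)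
    (h : ℕ) (χ : Fin h → Γ → ℂ)
    (hirr : ∀ j, ∃ V : FDRep ℂ Γ, CategoryTheory.Simple V ∧ χ j = V.character)
    (hdistinct : Function.Injective χ)
    (hcomplete : ∀ V : FDRep ℂ Γ, CategoryTheory.Simple V → ∃ j, χ j = V.character)
    (d : Fin h → ℕ) (hd : ∀ j, χ j 1 = d j) :
    (hermitianAdjMatrix S).charpoly
      = ∏ j : Fin h,
          (Polynomial.X - Polynomial.C
            ((Complex.I / χ j 1) * ∑ s ∈ S, (χ j s - χ j s⁻¹))) ^ (d j) ^ 2 := by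
  set f : Γ → ℂ := fun g =>
    Complex.I * ((if g ∈ S then 1 else 0) - (if g⁻¹ ∈ S then 1 else 0)) with hfdef
  have hconj : ∀ g x : Γ, x * g * x⁻¹ ∈ S ↔ g ∈ S := fun g x =>
    ⟨fun hg => by simpa [mul_assoc] using hnormal _ hg x⁻¹, fun hg => hnormal g hg x⟩
  have hf : ∀ g x, f (x * g * x⁻¹) = f g := by
    intro g x
    have hinv : (x * g * x⁻¹)⁻¹ = x * g⁻¹ * x⁻¹ := by group
    simp only [hfdef, hinv, hconj]
  have hsum : ∀ j, ∑ g, f g * χ j g = Complex.I * ∑ s ∈ S, (χ j s - χ j s⁻¹) := by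
    intro j
    have hinv : ∑ g : Γ, (if g⁻¹ ∈ S then χ j g else 0) = ∑ s ∈ S, χ j s⁻¹ := by
      rw [← Equiv.sum_comp (Equiv.inv Γ)]
      simp
    have hid : ∑ g : Γ, (if g ∈ S then χ j g else 0) = ∑ s ∈ S, χ j s := by simp
    rw [Finset.sum_sub_distrib, ← hinv, ← hid, ← Finset.sum_sub_distrib, Finset.mul_sum]
    refine Finset.sum_congr rfl fun g _ => ?_
    simp only [hfdef]
    split_ifs <;> ring
  have hmat : (hermitianAdjMatrix S).transpose.toLin'
      = (Representation.regularOnFunctions ℂ Γ).weightedSum f := by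
    refine LinearMap.ext fun v => funext fun a => ?_
    simp only [Matrix.toLin'_apply, Matrix.mulVec, dotProduct, Matrix.transpose_apply,
      Representation.weightedSum, LinearMap.sum_apply, LinearMap.smul_apply, Finset.sum_apply,
      Pi.smul_apply, smul_eq_mul, Representation.regularOnFunctions_apply]
    refine Fintype.sum_equiv ((Equiv.inv Γ).trans (Equiv.mulLeft a)) _ _ fun b => ?_
    have hab : (a * b⁻¹)⁻¹ = b * a⁻¹ := by group
    have hsk := hskew (a * b⁻¹)
    rw [hab] at hsk
    simp only [Equiv.trans_apply, Equiv.inv_apply, Equiv.coe_mulLeft, hfdef, hab,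
      hermitianAdjMatrix, Matrix.of_apply]
    by_cases h₁ : a * b⁻¹ ∈ S
    · simp [h₁, hsk h₁]
    · by_cases h₂ : b * a⁻¹ ∈ S <;> simp [h₁, h₂]
  obtain ⟨n, hn, hn'⟩ := Representation.exists_multiplicities χ hcomplete d hd hf _ _
    (Representation.regularOnFunctions ℂ Γ) rfl
  have hnd : ∀ j, n j = d j := fun j => by
    have := Representation.multiplicity_eq_degree χ hirr hdistinct n hn j
    rw [hd] at this
    exact_mod_cast this
  rw [← Matrix.charpoly_transpose, ← Matrix.charpoly_toLin', hmat, hn']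
  refine Finset.prod_congr rfl fun j _ => ?_
  rw [hsum, hnd, sq, div_mul_eq_mul_div]
end
end

section
/- Let Γ be a finite group, S ⊆ Γ with 1 ∉ S, and S a union of conjugacy classes of Γ. Then Cay(Γ,S) is H-integral if and only if Cay(Γ, S∖S̄) is H-integral and Cay(Γ, S̄) is H-integral; that is, every eigenvalue of the Hermitian adjacency matrix of Cay(Γ,S) is an integer if and only if every eigenvalue of the Hermitian adjacency matrix of Cay(Γ, S∖S̄) is an integer and every eigenvalue of the Hermitian adjacency matrix of Cay(Γ, S̄) is an integer. -/
open scoped Classical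

noncomputable section

/-- A matrix is H-integral (here: "integral") if all of its eigenvalues are integers. -/
def MatrixIntegral {Γ : Type} [Fintype Γ] [DecidableEq Γ] (M : Matrix Γ Γ ℂ) : Prop :=
  ∀ z ∈ spectrum ℂ M, ∃ k : ℤ, z = (k : ℂ)

lemma Matrix.mem_spectrum_iff_exists_mulVec {n : Type} [Fintype n] [DecidableEq n]
    {M : Matrix n n ℂ} {z : ℂ} :
    z ∈ spectrum ℂ M ↔ ∃ v : n → ℂ, v ≠ 0 ∧ M.mulVec v = z • v := by
  rw [← Matrix.spectrum_toLin', ← Module.End.hasEigenvalue_iff_mem_spectrum]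
  constructor
  · intro h
    obtain ⟨v, hv⟩ := h.exists_hasEigenvector
    exact ⟨v, hv.2, by simpa using hv.apply_eq_smul⟩
  · rintro ⟨v, hv, h⟩
    exact Module.End.hasEigenvalue_of_hasEigenvector (x := v)
      ⟨Module.End.mem_eigenspace_iff.2 (by simpa using h), hv⟩

/-- Every eigenvalue of a complex matrix has an eigenvector in common with any matrix that
commutes with it. -/
lemma Matrix.exists_common_eigenvector {n : Type} [Fintype n] [DecidableEq n]
    {A B : Matrix n n ℂ} (hAB : Commute A B) {a : ℂ} (ha : a ∈ spectrum ℂ A) :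
    ∃ (v : n → ℂ) (b : ℂ), v ≠ 0 ∧ A.mulVec v = a • v ∧ B.mulVec v = b • v := by
  have hcomm : Commute (Matrix.toLin' A) (Matrix.toLin' B) := by
    rw [commute_iff_eq, Module.End.mul_eq_comp, Module.End.mul_eq_comp, ← Matrix.toLin'_mul,
      ← Matrix.toLin'_mul, hAB.eq]
  rw [← Matrix.spectrum_toLin', ← Module.End.hasEigenvalue_iff_mem_spectrum] at ha
  have hmaps := Module.End.mapsTo_genEigenspace_of_comm hcomm a 1
  have : Nontrivial (Module.End.eigenspace (Matrix.toLin' A) a) :=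
    Submodule.nontrivial_iff_ne_bot.2 ha
  obtain ⟨b, hb⟩ := Module.End.exists_eigenvalue ((Matrix.toLin' B).restrict hmaps)
  obtain ⟨v, hv⟩ := hb.exists_hasEigenvector
  refine ⟨v, b, fun h => hv.2 (Subtype.ext h), ?_, ?_⟩
  · simpa using Module.End.mem_eigenspace_iff.1 v.2
  · exact congrArg Subtype.val hv.apply_eq_smul

lemma Matrix.isIntegral_of_mem_spectrum_map_intCast {n : Type} [Fintype n] [DecidableEq n]
    (N : Matrix n n ℤ) {z : ℂ} (hz : z ∈ spectrum ℂ (N.map (Int.castRingHom ℂ))) :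
    IsIntegral ℤ z := by
  rw [Matrix.mem_spectrum_iff_isRoot_charpoly, Matrix.charpoly_map, Polynomial.IsRoot,
    Polynomial.eval_map] at hz
  exact ⟨N.charpoly, N.charpoly_monic, hz⟩

lemma Complex.exists_int_eq_of_isIntegral_of_two_mul {z : ℂ} (hz : IsIntegral ℤ z) {m : ℤ}
    (hm : 2 * z = m) : ∃ k : ℤ, z = k := by
  have hq : z = algebraMap ℚ ℂ (m / 2) := by
    simp [← hm]
  rw [hq, isIntegral_algebraMap_iff (algebraMap ℚ ℂ).injective] at hz
  obtain ⟨k, hk⟩ := IsIntegrallyClosed.isIntegral_iff.1 hz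
  exact ⟨k, by rw [hq, ← hk]; simp⟩

lemma Matrix.map_conj_mulVec_star {n : Type} [Fintype n] {M : Matrix n n ℂ} {v : n → ℂ} {z : ℂ}
    (h : M.mulVec v = z • v) : (M.map star).mulVec (star v) = star z • star v := by
  have := congrArg star h
  rw [star_smul] at this
  rw [← this]
  ext i
  simp [Matrix.mulVec, dotProduct]

/-- If `A` has integer entries, `B` has purely imaginary entries and `A` and `B` commute, then
the eigenvalues of `A + B` are integers exactly when those of both `A` and `B` are. -/
lemma matrixIntegral_add_iff {n : Type} [Fintype n] [DecidableEq n] (N : Matrix n n ℤ)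
    {B : Matrix n n ℂ} (hB : B.map star = -B)
    (hcomm : Commute (N.map (Int.castRingHom ℂ)) B) :
    MatrixIntegral (N.map (Int.castRingHom ℂ) + B) ↔
      MatrixIntegral (N.map (Int.castRingHom ℂ)) ∧ MatrixIntegral B := by
  set A := N.map (Int.castRingHom ℂ) with hA
  have hAstar : A.map star = A := by
    ext i j
    simp [hA]
  constructor
  · intro h
    have key : ∀ (v : n → ℂ) (a b : ℂ), v ≠ 0 → A.mulVec v = a • v → B.mulVec v = b • v →
        (∃ k : ℤ, a = k) ∧ ∃ k : ℤ, b = k := by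
      intro v a b hv hav hbv
      have hint : IsIntegral ℤ a := N.isIntegral_of_mem_spectrum_map_intCast
        (Matrix.mem_spectrum_iff_exists_mulVec.2 ⟨v, hv, hav⟩)
      obtain ⟨k, hk⟩ := h (a + b) (Matrix.mem_spectrum_iff_exists_mulVec.2
        ⟨v, hv, by rw [Matrix.add_mulVec, hav, hbv, add_smul]⟩)
      have ha' := Matrix.map_conj_mulVec_star hav
      have hb' := Matrix.map_conj_mulVec_star hbv
      rw [hAstar] at ha'
      rw [hB, Matrix.neg_mulVec, neg_eq_iff_eq_neg] at hb'
      obtain ⟨l, hl⟩ := h (star a - star b) (Matrix.mem_spectrum_iff_exists_mulVec.2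
        ⟨star v, star_ne_zero.2 hv, by rw [Matrix.add_mulVec, ha', hb', sub_smul, sub_eq_add_neg]⟩)
      have hl' : a - b = l := by
        simpa using congrArg star hl
      obtain ⟨j, hj⟩ := Complex.exists_int_eq_of_isIntegral_of_two_mul hint (m := k + l)
        (by push_cast; rw [← hk, ← hl']; ring)
      exact ⟨⟨j, hj⟩, k - j, by push_cast; rw [← hk, ← hj]; ring⟩
    constructor
    · intro a ha
      obtain ⟨v, b, hv, hav, hbv⟩ := Matrix.exists_common_eigenvector hcomm ha
      exact (key v a b hv hav hbv).1
    · intro b hb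
      obtain ⟨v, a, hv, hbv, hav⟩ := Matrix.exists_common_eigenvector hcomm.symm hb
      exact (key v a b hv hav hbv).2
  · rintro ⟨hAint, hBint⟩ z hz
    obtain ⟨v, a, hv, hzv, hav⟩ := Matrix.exists_common_eigenvector
      ((Commute.refl A).add_left hcomm.symm) hz
    have hbv : B.mulVec v = (z - a) • v := by
      rw [sub_smul, ← hzv, ← hav, Matrix.add_mulVec, add_sub_cancel_left]
    obtain ⟨k, hk⟩ := hAint a (Matrix.mem_spectrum_iff_exists_mulVec.2 ⟨v, hv, hav⟩)
    obtain ⟨l, hl⟩ := hBint _ (Matrix.mem_spectrum_iff_exists_mulVec.2 ⟨v, hv, hbv⟩)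
    exact ⟨k + l, by push_cast; rw [← hk, ← hl]; ring⟩

/-- The matrix of a class function on a finite group commutes with the matrix of any function. -/
lemma commute_of_classFunction {Γ : Type} [Group Γ] [Fintype Γ] [DecidableEq Γ] {f g : Γ → ℂ}
    (hf : ∀ s x, f (x * s * x⁻¹) = f s) :
    Commute (Matrix.of fun a b => f (b * a⁻¹)) (Matrix.of fun a b => g (b * a⁻¹)) := by
  ext a b
  simp only [Matrix.mul_apply, Matrix.of_apply]
  refine Fintype.sum_equiv (((Equiv.inv Γ).trans (Equiv.mulLeft b)).trans (Equiv.mulRight a)) _ _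
    fun c => ?_
  have h : b * (b * c⁻¹ * a)⁻¹ = (b * a⁻¹) * (c * a⁻¹) * (b * a⁻¹)⁻¹ := by group
  simp only [Equiv.trans_apply, Equiv.inv_apply, Equiv.coe_mulLeft, Equiv.coe_mulRight]
  rw [h, hf, mul_comm]
  simp

/-- A normal mixed Cayley graph `Cay(Γ, S)` is H-integral if and only if
`Cay(Γ, S∖S̄)` is H-integral and `Cay(Γ, S̄)` is H-integral. -/
theorem normal_mixed_cayley_HIntegral_iff_parts
    (Γ : Type) [Group Γ] [Fintype Γ] [DecidableEq Γ]
    (S : Finset Γ) (hS1 : (1 : Γ) ∉ S)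
    (hnormal : ∀ s ∈ S, ∀ x : Γ, x * s * x⁻¹ ∈ S) :
    MatrixIntegral (hermitianAdjMatrix S)
      ↔ MatrixIntegral (hermitianAdjMatrix (S \ S.filter (fun s => s⁻¹ ∉ S)))
        ∧ MatrixIntegral (hermitianAdjMatrix (S.filter (fun s => s⁻¹ ∉ S))) := by
  have hconj : ∀ s x : Γ, x * s * x⁻¹ ∈ S ↔ s ∈ S := fun s x =>
    ⟨fun h => by simpa [mul_assoc] using hnormal _ h x⁻¹, fun h => hnormal s h x⟩
  let N : Matrix Γ Γ ℤ := Matrix.of fun a b => if b * a⁻¹ ∈ S ∧ a * b⁻¹ ∈ S then 1 else 0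
  let f : Γ → ℂ := fun s => if s ∈ S ∧ s⁻¹ ∈ S then 1 else 0
  let g : Γ → ℂ := fun s =>
    if s ∈ S then (if s⁻¹ ∈ S then 0 else Complex.I) else (if s⁻¹ ∈ S then -Complex.I else 0)
  have hf : ∀ s x, f (x * s * x⁻¹) = f s := by
    intro s x
    have h : (x * s * x⁻¹)⁻¹ = x * s⁻¹ * x⁻¹ := by group
    simp only [f, h, hconj]
  have hN : hermitianAdjMatrix (S \ S.filter (fun s => s⁻¹ ∉ S)) =
      N.map (Int.castRingHom ℂ) := by
    ext a b
    by_cases h₁ : b * a⁻¹ ∈ S <;> by_cases h₂ : a * b⁻¹ ∈ S <;>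
      simp [hermitianAdjMatrix, N, h₁, h₂]
  have hNf : N.map (Int.castRingHom ℂ) = Matrix.of fun a b => f (b * a⁻¹) := by
    ext a b
    by_cases h₁ : b * a⁻¹ ∈ S <;> by_cases h₂ : a * b⁻¹ ∈ S <;>
      simp [N, f, h₁, h₂]
  have hg : hermitianAdjMatrix (S.filter (fun s => s⁻¹ ∉ S)) =
      Matrix.of fun a b => g (b * a⁻¹) := by
    ext a b
    by_cases h₁ : b * a⁻¹ ∈ S <;> by_cases h₂ : a * b⁻¹ ∈ S <;>
      simp [hermitianAdjMatrix, g, h₁, h₂]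
  have hsum : hermitianAdjMatrix S =
      N.map (Int.castRingHom ℂ) + Matrix.of fun a b => g (b * a⁻¹) := by
    ext a b
    by_cases h₁ : b * a⁻¹ ∈ S <;> by_cases h₂ : a * b⁻¹ ∈ S <;>
      simp [hermitianAdjMatrix, N, g, h₁, h₂]
  rw [hN, hg, hsum]
  refine matrixIntegral_add_iff N ?_ (hNf ▸ commute_of_classFunction hf)
  ext a b
  by_cases h₁ : b * a⁻¹ ∈ S <;> by_cases h₂ : a * b⁻¹ ∈ S <;>
    simp [g, h₁, h₂]
end
end

section
/- Let Γ be a finite group, S ⊆ Γ with 1 ∉ S, S skew-symmetric (s ∈ S implies s⁻¹ ∉ S), and S a union of conjugacy classes of Γ (so Cay(Γ,S) is a normal oriented Cayley graph). Then Cay(Γ,S) is H-integral if and only if S ∈ D(Γ), i.e., if and only if S ⊆ Γ(4) and ⟦x⟧ ⊆ S for every x ∈ S. -/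
open scoped Classical

noncomputable section

/-- `⟦x⟧ = {x^k : 1 ≤ k ≤ ord(x)−1, gcd(k, ord(x)) = 1, k ≡ 1 (mod 4)}`. -/
def bracket4 {Γ : Type} [Group Γ] (x : Γ) : Set Γ :=
  {y | ∃ k : ℕ, 1 ≤ k ∧ k ≤ orderOf x - 1 ∧ Nat.gcd k (orderOf x) = 1 ∧ k % 4 = 1 ∧ y = x ^ k}

section SpectralProjection

open Polynomial

theorem nodal_id_dvd_sub {s : Finset ℂ} {p q : ℂ[X]} (h : ∀ μ ∈ s, p.eval μ = q.eval μ) :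
    Lagrange.nodal s id ∣ p - q := by
  refine Finset.prod_dvd_of_coprime (fun a _ b _ hab => ?_) fun μ hμ => ?_
  · exact pairwise_coprime_X_sub_C Function.injective_id hab
  · exact dvd_iff_isRoot.2 (by simp [h μ hμ])

variable {A : Type*} [Ring A] [Algebra ℂ A]

theorem aeval_eq_of_eval_eq {s : Finset ℂ} {T : A} (hT : aeval T (Lagrange.nodal s id) = 0)
    {p q : ℂ[X]} (h : ∀ μ ∈ s, p.eval μ = q.eval μ) : aeval T p = aeval T q := by
  obtain ⟨r, hr⟩ := nodal_id_dvd_sub h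
  rw [← sub_eq_zero, ← map_sub, hr, map_mul, hT, zero_mul]

/-- The projection onto the `μ`-eigenspace of an element annihilated by `∏ ν ∈ s, (X - ν)`. -/
def spectralProjection (s : Finset ℂ) (T : A) (μ : ℂ) : A :=
  aeval T (Lagrange.basis s id μ)

theorem eval_basis_id {s : Finset ℂ} {μ ν : ℂ} (hμ : μ ∈ s) (hν : ν ∈ s) :
    (Lagrange.basis s id μ).eval ν = if μ = ν then 1 else 0 := by
  split_ifs with h
  · subst h
    exact Lagrange.eval_basis_self (v := id) Function.injective_id.injOn hμ
  · exact Lagrange.eval_basis_of_ne (v := id) h hν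

theorem spectralProjection_isIdempotentElem {s : Finset ℂ} {T : A}
    (hT : aeval T (Lagrange.nodal s id) = 0) {μ : ℂ} (hμ : μ ∈ s) :
    IsIdempotentElem (spectralProjection s T μ) := by
  rw [IsIdempotentElem, spectralProjection, ← map_mul]
  refine aeval_eq_of_eval_eq hT fun ν hν => ?_
  simp [eval_basis_id hμ hν]

theorem mul_spectralProjection {s : Finset ℂ} {T : A}
    (hT : aeval T (Lagrange.nodal s id) = 0) {μ : ℂ} (hμ : μ ∈ s) :
    T * spectralProjection s T μ = μ • spectralProjection s T μ := by
  have : aeval T (X * Lagrange.basis s id μ) = aeval T (C μ * Lagrange.basis s id μ) := by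
    refine aeval_eq_of_eval_eq hT fun ν hν => ?_
    by_cases h : μ = ν <;> simp [eval_basis_id hμ hν, h]
  simpa [spectralProjection, Algebra.smul_def] using this

theorem aeval_eq_sum_spectralProjection {s : Finset ℂ} {T : A}
    (hT : aeval T (Lagrange.nodal s id) = 0) (p : ℂ[X]) :
    aeval T p = ∑ μ ∈ s, p.eval μ • spectralProjection s T μ := by
  have : aeval T p = aeval T (∑ μ ∈ s, C (p.eval μ) * Lagrange.basis s id μ) := by
    refine aeval_eq_of_eval_eq hT fun ν hν => ?_
    rw [eval_finsetSum, Finset.sum_eq_single_of_mem ν hν]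
    · simp [eval_basis_id hν hν]
    · intro μ hμ hne
      simp [eval_basis_id hμ hν, hne]
  simpa [spectralProjection, Algebra.smul_def] using this

theorem Commute.spectralProjection_right {U T : A} (h : Commute U T) (s : Finset ℂ) (μ : ℂ) :
    Commute U (spectralProjection s T μ) := by
  refine Algebra.commute_of_mem_adjoin_singleton_of_commute (R := ℂ) ?_ h
  exact aeval_mem_adjoin_singleton ℂ T

theorem spectralProjection_ne_zero [Nontrivial A] {s : Finset ℂ} {T : A} {μ : ℂ} (hμ : μ ∈ s)
    (hspec : μ ∈ spectrum ℂ T) : spectralProjection s T μ ≠ 0 := by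
  intro h
  have := spectrum.subset_polynomial_aeval T (Lagrange.basis s id μ) ⟨μ, hspec, rfl⟩
  change _ ∈ spectrum ℂ (spectralProjection s T μ) at this
  simp [h, eval_basis_id hμ hμ] at this

end SpectralProjection

section Matrix

variable {ι : Type*} [Fintype ι] [DecidableEq ι]

theorem IsIdempotentElem.exists_trace_eq_natCast {P : Matrix ι ι ℂ} (hP : IsIdempotentElem P) :
    ∃ m : ℕ, P.trace = m := by
  have h : IsIdempotentElem (Matrix.toLinAlgEquiv' P) := hP.map _
  refine ⟨Module.finrank ℂ (LinearMap.range (Matrix.toLinAlgEquiv' P)), ?_⟩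
  rw [← (LinearMap.IsIdempotentElem.isProj_range _ h).trace]
  exact (Matrix.trace_toLin'_eq P).symm

theorem IsIdempotentElem.matrix_trace_ne_zero {P : Matrix ι ι ℂ} (hP : IsIdempotentElem P)
    (h0 : P ≠ 0) : P.trace ≠ 0 := by
  have h : IsIdempotentElem (Matrix.toLinAlgEquiv' P) := hP.map _
  rw [← Matrix.trace_toLin'_eq P]
  intro h1
  apply h0
  have := (LinearMap.IsIdempotentElem.trace_eq_zero_iff h).1 h1
  simpa using this

open Polynomial in
theorem Matrix.IsHermitian.aeval_nodal_spectrum {H : Matrix ι ι ℂ} (hH : H.IsHermitian) :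
    aeval H (Lagrange.nodal H.finite_spectrum.toFinset id) = 0 := by
  set p := Lagrange.nodal H.finite_spectrum.toFinset id
  have hdiag : aeval (Matrix.diagonal (RCLike.ofReal ∘ hH.eigenvalues) : Matrix ι ι ℂ) p = 0 := by
    have h := aeval_algHom_apply (Matrix.diagonalAlgHom ℂ)
      (RCLike.ofReal ∘ hH.eigenvalues : ι → ℂ) p
    rw [Matrix.diagonalAlgHom_apply] at h
    rw [h, Matrix.diagonalAlgHom_apply, Matrix.diagonal_eq_zero]
    ext i
    have hi : (hH.eigenvalues i : ℂ) ∈ H.finite_spectrum.toFinset := by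
      simp [hH.spectrum_eq_image_range]
    have h2 := aeval_algHom_apply (Pi.evalAlgHom ℂ (fun _ : ι => ℂ) i)
      (RCLike.ofReal ∘ hH.eigenvalues : ι → ℂ) p
    refine h2.symm.trans ?_
    exact Lagrange.eval_nodal_at_node (v := id) hi
  conv_lhs => rw [hH.spectral_theorem]
  rw [aeval_algHom_apply, hdiag, map_zero]

end Matrix

section CyclotomicFamily

open Polynomial

/-- The functions `ℕ+ → ℂ` of the form `k ↦ Q (ζ ^ k)` for a rational polynomial `Q`. -/
def cyclotomicFamilies (ζ : ℂ) : Subalgebra ℚ (ℕ+ → ℂ) :=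
  Algebra.adjoin ℚ {fun k : ℕ+ => ζ ^ (k : ℕ)}

theorem exists_aeval_of_mem_cyclotomicFamilies {ζ : ℂ} {F : ℕ+ → ℂ}
    (hF : F ∈ cyclotomicFamilies ζ) : ∃ Q : ℚ[X], ∀ k : ℕ+, F k = aeval (ζ ^ (k : ℕ)) Q := by
  rw [cyclotomicFamilies, Algebra.adjoin_singleton_eq_range_aeval] at hF
  obtain ⟨Q, rfl⟩ := hF
  refine ⟨Q, fun k => ?_⟩
  exact (aeval_algHom_apply (Pi.evalAlgHom ℚ (fun _ : ℕ+ => ℂ) k) _ Q).symm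

theorem pow_mem_cyclotomicFamilies (ζ : ℂ) (j : ℕ) :
    (fun k : ℕ+ => (ζ ^ j) ^ (k : ℕ)) ∈ cyclotomicFamilies ζ := by
  convert! pow_mem (Algebra.self_mem_adjoin_singleton ℚ (fun k : ℕ+ => ζ ^ (k : ℕ))) j using 1
  ext k
  simp [← pow_mul, mul_comm]

theorem const_mem_cyclotomicFamilies (ζ : ℂ) (q : ℚ) :
    (fun _ : ℕ+ => (q : ℂ)) ∈ cyclotomicFamilies ζ :=
  (cyclotomicFamilies ζ).algebraMap_mem q

theorem eq_zero_of_mem_cyclotomicFamilies {ζ : ℂ} {n : ℕ} (hζ : IsPrimitiveRoot ζ n) (hn : 0 < n)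
    {F : ℕ+ → ℂ} (hF : F ∈ cyclotomicFamilies ζ) (h1 : F 1 = 0) {k : ℕ+}
    (hk : Nat.Coprime k n) : F k = 0 := by
  obtain ⟨Q, hQ⟩ := exists_aeval_of_mem_cyclotomicFamilies hF
  have hdvd : minpoly ℚ ζ ∣ Q := minpoly.dvd ℚ ζ (by simpa [h1] using (hQ 1).symm)
  rw [← cyclotomic_eq_minpoly_rat hζ hn,
    cyclotomic_eq_minpoly_rat (hζ.pow_of_coprime k hk) hn] at hdvd
  rw [hQ k]
  exact (minpoly.dvd_iff).1 hdvd

theorem exists_rat_of_mem_cyclotomicFamilies {ζ : ℂ} {n : ℕ} (hζ : IsPrimitiveRoot ζ n)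
    (hn : 1 < n) {F : ℕ+ → ℂ} (hF : F ∈ cyclotomicFamilies ζ) {x : ℂ}
    (hx : ∀ k : ℕ+, Nat.Coprime k n → F k = x) : ∃ q : ℚ, x = q := by
  obtain ⟨Q, hQ⟩ := exists_aeval_of_mem_cyclotomicFamilies hF
  have : NeZero n := ⟨by omega⟩
  have hdvd : cyclotomic n ℂ ∣ Q.map (algebraMap ℚ ℂ) - C x := by
    rw [cyclotomic_eq_prod_X_sub_primitiveRoots hζ]
    refine nodal_id_dvd_sub fun μ hμ => ?_
    obtain ⟨i, -, hi, rfl⟩ := hζ.isPrimitiveRoot_iff.1 ((mem_primitiveRoots (by omega)).1 hμ)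
    have hi0 : 0 < i := Nat.pos_of_ne_zero (by rintro rfl; simp at hi; omega)
    rw [eval_map_algebraMap, eval_C, ← hx (Nat.toPNat i hi0) hi, hQ]
    rfl
  have hmod : (Q %ₘ cyclotomic n ℚ).map (algebraMap ℚ ℂ) = C x := by
    rw [map_modByMonic _ (cyclotomic.monic n ℚ), map_cyclotomic]
    refine (modByMonic_eq_of_dvd_sub (cyclotomic.monic n ℂ) hdvd).trans ?_
    refine (modByMonic_eq_self_iff (cyclotomic.monic n ℂ)).2 (degree_C_le.trans_lt ?_)
    exact degree_cyclotomic_pos n ℂ (by omega)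
  refine ⟨(Q %ₘ cyclotomic n ℚ).coeff 0, ?_⟩
  simpa using (congrArg (coeff · 0) hmod).symm

theorem trace_mul_pow_mem_cyclotomicFamilies {ι : Type*} [Fintype ι] [DecidableEq ι] {ζ : ℂ}
    {n : ℕ} (hζ : IsPrimitiveRoot ζ n) (hn : 0 < n) {P T : Matrix ι ι ℂ}
    (hP : IsIdempotentElem P) (hPT : Commute P T) (hT : T ^ n = 1) :
    (fun k : ℕ+ => (P * T ^ (k : ℕ)).trace) ∈ cyclotomicFamilies ζ := by
  have : NeZero n := ⟨hn.ne'⟩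
  have hT' : aeval T (Lagrange.nodal (nthRootsFinset n (1 : ℂ)) id) = 0 := by
    have h : Lagrange.nodal (nthRootsFinset n (1 : ℂ)) id = X ^ n - 1 :=
      (X_pow_sub_one_eq_prod hn hζ).symm
    simp [h, hT]
  have hsum : (fun k : ℕ+ => (P * T ^ (k : ℕ)).trace) = ∑ μ ∈ nthRootsFinset n (1 : ℂ),
      (fun k : ℕ+ => μ ^ (k : ℕ)) *
        fun _ => (P * spectralProjection (nthRootsFinset n (1 : ℂ)) T μ).trace := by
    ext k
    have h := aeval_eq_sum_spectralProjection hT' (X ^ (k : ℕ))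
    simp only [map_pow, aeval_X, eval_pow, eval_X] at h
    simp [h, Finset.mul_sum, Matrix.trace_sum]
  rw [hsum]
  refine sum_mem fun μ hμ => mul_mem ?_ ?_
  · obtain ⟨j, -, rfl⟩ := hζ.eq_pow_of_pow_eq_one ((mem_nthRootsFinset hn 1).1 hμ)
    exact pow_mem_cyclotomicFamilies ζ j
  · obtain ⟨m, hm⟩ := (IsIdempotentElem.mul_of_commute (hPT.spectralProjection_right _ μ) hP
      (spectralProjection_isIdempotentElem hT' hμ)).exists_trace_eq_natCast
    simpa [hm] using const_mem_cyclotomicFamilies ζ m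

end CyclotomicFamily

section CayleyGraph

open Matrix

variable {Γ : Type} [Group Γ] {S : Finset Γ}

theorem pow_mem_of_bracket4_subset [Finite Γ] {n : ℕ} (h4 : ∀ x ∈ S, 4 ∣ orderOf x)
    (hbr : ∀ x ∈ S, bracket4 x ⊆ (S : Set Γ)) {g : Γ} (hg : g ∈ S) (hn : orderOf g ∣ n) {k : ℕ}
    (hk : k.Coprime n) (hk1 : k % 4 = 1) : g ^ k ∈ S := by
  have hmod : k % orderOf g % 4 = 1 := by rw [Nat.mod_mod_of_dvd _ (h4 g hg), hk1]
  refine hbr g hg ⟨k % orderOf g, ?_, ?_, ?_, hmod, (pow_mod_orderOf g k).symm⟩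
  · omega
  · exact Nat.le_sub_one_of_lt (Nat.mod_lt _ (orderOf_pos g))
  · rw [← Nat.gcd_rec, Nat.gcd_comm]
    exact hk.coprime_dvd_right hn

variable [DecidableEq Γ]

/-- The signed indicator function of `S`, with value `1` on `S` and `-1` on `S⁻¹`. -/
def signedIndicator (S : Finset Γ) (g : Γ) : ℤ :=
  if g ∈ S then 1 else if g⁻¹ ∈ S then -1 else 0

theorem signedIndicator_eq_one_iff {g : Γ} : signedIndicator S g = 1 ↔ g ∈ S := by
  unfold signedIndicator
  split_ifs <;> simp_all

theorem signedIndicator_inv (hskew : ∀ s ∈ S, s⁻¹ ∉ S) (g : Γ) :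
    signedIndicator S g⁻¹ = -signedIndicator S g := by
  have := hskew g
  unfold signedIndicator
  rw [inv_inv]
  split_ifs <;> simp_all

theorem signedIndicator_conj (hnormal : ∀ s ∈ S, ∀ x : Γ, x * s * x⁻¹ ∈ S) (g x : Γ) :
    signedIndicator S (x * g * x⁻¹) = signedIndicator S g := by
  have h (s : Γ) : x * s * x⁻¹ ∈ S ↔ s ∈ S :=
    ⟨fun hs => by simpa [mul_assoc] using hnormal _ hs x⁻¹, fun hs => hnormal s hs x⟩
  simp only [signedIndicator, conj_inv, h]

theorem signedIndicator_mul_comm (hnormal : ∀ s ∈ S, ∀ x : Γ, x * s * x⁻¹ ∈ S) (g x : Γ) :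
    signedIndicator S (x * g) = signedIndicator S (g * x) := by
  simpa [mul_assoc] using signedIndicator_conj hnormal (g * x) x

variable [Fintype Γ]

/-- The matrix of translation by `g` on `Γ → ℂ`. -/
def translationMatrix (g : Γ) : Matrix Γ Γ ℂ :=
  Matrix.of fun a b => if b = g * a then 1 else 0

theorem translationMatrix_mul_apply (g : Γ) (M : Matrix Γ Γ ℂ) (a b : Γ) :
    (translationMatrix g * M) a b = M (g * a) b := by
  simp [translationMatrix, Matrix.mul_apply]

theorem mul_translationMatrix_apply (g : Γ) (M : Matrix Γ Γ ℂ) (a b : Γ) :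
    (M * translationMatrix g) a b = M a (g⁻¹ * b) := by
  simp [translationMatrix, Matrix.mul_apply, ← inv_mul_eq_iff_eq_mul]

theorem translationMatrix_pow (g : Γ) (k : ℕ) :
    translationMatrix g ^ k = translationMatrix (g ^ k) := by
  induction k with
  | zero =>
    ext a b
    simp [translationMatrix, Matrix.one_apply, eq_comm]
  | succ k ih =>
    ext a b
    rw [pow_succ', translationMatrix_mul_apply, ih]
    simp [translationMatrix, pow_succ, mul_assoc]

theorem translationMatrix_pow_eq_one (g : Γ) {n : ℕ} (hn : Fintype.card Γ ∣ n) :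
    translationMatrix g ^ n = 1 := by
  obtain ⟨m, rfl⟩ := hn
  rw [translationMatrix_pow, pow_mul, pow_card_eq_one, one_pow, ← pow_zero (1 : Γ),
    ← translationMatrix_pow, pow_zero]

theorem hermitianAdjMatrix_apply (hskew : ∀ s ∈ S, s⁻¹ ∉ S) (a b : Γ) :
    hermitianAdjMatrix S a b = signedIndicator S (b * a⁻¹) * Complex.I := by
  have := hskew (b * a⁻¹)
  simp only [hermitianAdjMatrix, signedIndicator, of_apply, _root_.mul_inv_rev, inv_inv] at this ⊢
  split_ifs <;> simp_all

theorem hermitianAdjMatrix_isHermitian (hskew : ∀ s ∈ S, s⁻¹ ∉ S) :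
    (hermitianAdjMatrix S).IsHermitian := by
  ext a b
  rw [conjTranspose_apply, hermitianAdjMatrix_apply hskew, hermitianAdjMatrix_apply hskew,
    ← inv_inv (b * a⁻¹), signedIndicator_inv hskew (b * a⁻¹)⁻¹]
  simp

theorem commute_hermitianAdjMatrix_translationMatrix (hskew : ∀ s ∈ S, s⁻¹ ∉ S)
    (hnormal : ∀ s ∈ S, ∀ x : Γ, x * s * x⁻¹ ∈ S) (g : Γ) :
    Commute (hermitianAdjMatrix S) (translationMatrix g) := by
  ext a b
  rw [mul_translationMatrix_apply, translationMatrix_mul_apply, hermitianAdjMatrix_apply hskew,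
    hermitianAdjMatrix_apply hskew, mul_assoc, signedIndicator_mul_comm hnormal, _root_.mul_inv_rev,
    mul_assoc]

theorem trace_hermitianAdjMatrix_mul_translationMatrix (hskew : ∀ s ∈ S, s⁻¹ ∉ S) (g : Γ) :
    (hermitianAdjMatrix S * translationMatrix g).trace =
      Fintype.card Γ * (signedIndicator S g⁻¹ * Complex.I) := by
  simp [Matrix.trace, mul_translationMatrix_apply, hermitianAdjMatrix_apply hskew]

theorem hermitianAdjMatrix_eq_sum (hskew : ∀ s ∈ S, s⁻¹ ∉ S) :
    hermitianAdjMatrix S =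
      ∑ g, ((signedIndicator S g : ℂ) * Complex.I) • translationMatrix g := by
  ext a b
  rw [hermitianAdjMatrix_apply hskew, Matrix.sum_apply, Finset.sum_eq_single (b * a⁻¹)]
  · simp [translationMatrix]
  · intro g _ hg
    have : b ≠ g * a := fun h => hg (by simp [h])
    simp [translationMatrix, this]
  · simp

theorem isIntegral_hermitianAdjMatrix (hskew : ∀ s ∈ S, s⁻¹ ∉ S) :
    IsIntegral ℤ (hermitianAdjMatrix S) := by
  let C : Matrix Γ Γ ℤ := Matrix.of fun a b => signedIndicator S (b * a⁻¹)
  have hC : hermitianAdjMatrix S = Complex.I • (Int.castRingHom ℂ).mapMatrix C := by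
    ext a b
    simp [C, hermitianAdjMatrix_apply hskew, mul_comm]
  refine IsIntegral.of_pow (n := 2) two_pos ?_
  have h2 : hermitianAdjMatrix S ^ 2 = (Algebra.ofId ℤ ℂ).mapMatrix (-(C ^ 2)) := by
    rw [hC, smul_pow, Complex.I_sq, neg_one_smul, map_neg, map_pow]
    rfl
  rw [h2]
  exact (Matrix.isIntegral _).map _

theorem isIntegral_of_mem_spectrum {A : Type*} [Ring A] [Algebra ℂ A] {T : A}
    (hT : IsIntegral ℤ T) {μ : ℂ} (hμ : μ ∈ spectrum ℂ T) : IsIntegral ℤ μ := by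
  obtain ⟨p, hp, h0⟩ := hT
  have h := spectrum.subset_polynomial_aeval T (p.map (algebraMap ℤ ℂ)) ⟨μ, hμ, rfl⟩
  have h0' : Polynomial.aeval T (p.map (algebraMap ℤ ℂ)) = 0 := by
    rw [Polynomial.aeval_map_algebraMap]
    exact h0
  rw [h0'] at h
  refine ⟨p, hp, ?_⟩
  rcases subsingleton_or_nontrivial A with _ | _
  · simp [spectrum.of_subsingleton] at h
  · simpa [Polynomial.eval_map] using h

theorem I_pow_of_mod_four_eq_three {k : ℕ} (hk : k % 4 = 3) : Complex.I ^ k = -Complex.I := by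
  rw [Complex.I_pow_eq_pow_mod, hk, Complex.I_pow_three]

theorem I_pow_of_mod_four_eq_one {k : ℕ} (hk : k % 4 = 1) : Complex.I ^ k = Complex.I := by
  rw [Complex.I_pow_eq_pow_mod, hk, pow_one]

theorem exists_primitiveRoot_pow_eq_I {m : ℕ} (hm : 0 < m) :
    ∃ ζ : ℂ, IsPrimitiveRoot ζ (4 * m) ∧ ζ ^ m = Complex.I := by
  refine ⟨_, Complex.isPrimitiveRoot_exp (4 * m) (by omega), ?_⟩
  have hm0 : (m : ℂ) ≠ 0 := by exact_mod_cast hm.ne'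
  have h : (m : ℂ) * (2 * Real.pi * Complex.I / ((4 * m : ℕ) : ℂ)) = Real.pi / 2 * Complex.I := by
    push_cast
    field_simp
    norm_num
  rw [← Complex.exp_nat_mul, h, Complex.exp_mul_I, Complex.cos_pi_div_two, Complex.sin_pi_div_two,
    zero_add, one_mul]

theorem I_pow_mem_cyclotomicFamilies {ζ : ℂ} {m : ℕ} (h : ζ ^ m = Complex.I) :
    (fun k : ℕ+ => Complex.I ^ (k : ℕ)) ∈ cyclotomicFamilies ζ := by
  rw [← h]
  exact pow_mem_cyclotomicFamilies ζ m

theorem signedIndicator_pow_of_integral (hskew : ∀ s ∈ S, s⁻¹ ∉ S)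
    (hnormal : ∀ s ∈ S, ∀ x : Γ, x * s * x⁻¹ ∈ S)
    (hint : MatrixIntegral (hermitianAdjMatrix S)) (g : Γ) {k : ℕ+}
    (hk : Nat.Coprime k (4 * Fintype.card Γ)) :
    (signedIndicator S (g ^ (k : ℕ)) : ℂ) * Complex.I =
      signedIndicator S g * Complex.I ^ (k : ℕ) := by
  set H := hermitianAdjMatrix S
  have hcard : 0 < Fintype.card Γ := Fintype.card_pos
  obtain ⟨ζ, hζ, hζI⟩ := exists_primitiveRoot_pow_eq_I hcard
  have hnodal := (hermitianAdjMatrix_isHermitian hskew).aeval_nodal_spectrum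
  set s := H.finite_spectrum.toFinset
  let F : ℕ+ → ℂ := ∑ μ ∈ s, (fun _ => μ) *
      (fun k : ℕ+ => (spectralProjection s H μ * translationMatrix g⁻¹ ^ (k : ℕ)).trace)
    - (fun _ => ((Fintype.card Γ * signedIndicator S g : ℚ) : ℂ)) *
      (fun k : ℕ+ => Complex.I ^ (k : ℕ))
  have hF : F ∈ cyclotomicFamilies ζ := by
    refine sub_mem (sum_mem fun μ hμ => mul_mem ?_ ?_)
      (mul_mem (const_mem_cyclotomicFamilies ζ _) (I_pow_mem_cyclotomicFamilies hζI))
    · obtain ⟨m, rfl⟩ := hint μ (by simpa [s] using hμ)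
      simpa using const_mem_cyclotomicFamilies ζ m
    · refine trace_mul_pow_mem_cyclotomicFamilies hζ (by omega)
        (spectralProjection_isIdempotentElem hnodal hμ) ?_
        (translationMatrix_pow_eq_one _ (dvd_mul_left _ _))
      exact ((commute_hermitianAdjMatrix_translationMatrix hskew hnormal
        g⁻¹).symm.spectralProjection_right s μ).symm
  have hF_apply (k : ℕ+) : F k = Fintype.card Γ * (signedIndicator S (g ^ (k : ℕ)) * Complex.I)
      - Fintype.card Γ * signedIndicator S g * Complex.I ^ (k : ℕ) := by
    have h := trace_hermitianAdjMatrix_mul_translationMatrix hskew (g⁻¹ ^ (k : ℕ))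
    have hH := aeval_eq_sum_spectralProjection hnodal Polynomial.X
    simp only [Polynomial.aeval_X, Polynomial.eval_X] at hH
    rw [inv_pow, inv_inv, ← inv_pow, ← translationMatrix_pow] at h
    rw [← h, hH]
    simp [F, H, Finset.sum_mul, Matrix.trace_sum]
  have h1 : F 1 = 0 := by
    rw [hF_apply]
    simp [mul_assoc]
  have hFk := eq_zero_of_mem_cyclotomicFamilies hζ (by omega) hF h1 hk
  rw [hF_apply, mul_assoc, ← mul_sub, mul_eq_zero, sub_eq_zero] at hFk
  exact hFk.resolve_left (by exact_mod_cast hcard.ne')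

theorem matrixIntegral_of_signedIndicator_pow (hskew : ∀ s ∈ S, s⁻¹ ∉ S)
    (hnormal : ∀ s ∈ S, ∀ x : Γ, x * s * x⁻¹ ∈ S)
    (hpow : ∀ (g : Γ) (k : ℕ), k.Coprime (4 * Fintype.card Γ) →
      (signedIndicator S (g ^ k) : ℂ) * Complex.I = signedIndicator S g * Complex.I ^ k) :
    MatrixIntegral (hermitianAdjMatrix S) := by
  intro μ hμ
  set H := hermitianAdjMatrix S with hHdef
  have hcard : 0 < Fintype.card Γ := Fintype.card_pos
  obtain ⟨ζ, hζ, hζI⟩ := exists_primitiveRoot_pow_eq_I hcard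
  have hnodal := (hermitianAdjMatrix_isHermitian hskew).aeval_nodal_spectrum
  set s := H.finite_spectrum.toFinset
  have hμs : μ ∈ s := by simpa [s] using hμ
  set P := spectralProjection s H μ
  have hP : IsIdempotentElem P := spectralProjection_isIdempotentElem hnodal hμs
  have hHP : (P * H).trace = μ * P.trace := by
    rw [Matrix.trace_mul_comm, mul_spectralProjection hnodal hμs, Matrix.trace_smul, smul_eq_mul]
  let F : ℕ+ → ℂ := ∑ g, (fun _ => ((signedIndicator S g : ℚ) : ℂ)) *
    (fun k : ℕ+ => Complex.I ^ (k : ℕ)) *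
      fun k : ℕ+ => (P * translationMatrix g ^ (k : ℕ)).trace
  have hF : F ∈ cyclotomicFamilies ζ := by
    refine sum_mem fun g _ => mul_mem (mul_mem (const_mem_cyclotomicFamilies ζ _)
      (I_pow_mem_cyclotomicFamilies hζI)) ?_
    refine trace_mul_pow_mem_cyclotomicFamilies hζ (by omega) hP ?_
      (translationMatrix_pow_eq_one _ (dvd_mul_left _ _))
    exact ((commute_hermitianAdjMatrix_translationMatrix hskew hnormal
      g).symm.spectralProjection_right s μ).symm
  have hFk (k : ℕ+) (hk : Nat.Coprime k (4 * Fintype.card Γ)) : F k = μ * P.trace := by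
    have hk' : (Nat.card Γ).Coprime k := by
      rw [Nat.card_eq_fintype_card]
      exact (Nat.Coprime.coprime_mul_left_right hk).symm
    rw [← hHP, hHdef, hermitianAdjMatrix_eq_sum hskew, ← (powCoprime hk').sum_comp]
    simp [F, Finset.mul_sum, Matrix.trace_sum, hpow _ _ hk, translationMatrix_pow]
  obtain ⟨q, hq⟩ := exists_rat_of_mem_cyclotomicFamilies hζ (by omega) hF hFk
  obtain ⟨m, hm⟩ := hP.exists_trace_eq_natCast
  have hm0 : (m : ℂ) ≠ 0 := hm ▸ hP.matrix_trace_ne_zero (spectralProjection_ne_zero hμs hμ)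
  have hμq : μ = ((q / m : ℚ) : ℂ) := by
    rw [hm] at hq
    push_cast
    rw [eq_div_iff hm0, hq]
  have hμint := isIntegral_of_mem_spectrum (isIntegral_hermitianAdjMatrix hskew) hμ
  rw [hμq] at hμint ⊢
  have hint : IsIntegral ℤ (q / m : ℚ) :=
    (isIntegral_algebraMap_iff (B := ℂ) (algebraMap ℚ ℂ).injective).1 hμint
  obtain ⟨z, hz⟩ := IsIntegrallyClosed.isIntegral_iff.1 hint
  exact ⟨z, by rw [← hz]; simp⟩

theorem exists_coprime_modEq {L n : ℕ} (hn : n ≠ 0) (hL : L ∣ n) {a : ℕ} (ha : a.Coprime L) :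
    ∃ k : ℕ, k.Coprime n ∧ k ≡ a [MOD L] := by
  have : NeZero n := ⟨hn⟩
  obtain ⟨u, hu⟩ := ZMod.unitsMap_surjective hL (ZMod.unitOfCoprime a ha)
  refine ⟨(u : ZMod n).val, ZMod.val_coe_unit_coprime u, ?_⟩
  rw [← ZMod.natCast_eq_natCast_iff, ZMod.natCast_val, ← ZMod.unitsMap_val hL, hu,
    ZMod.coe_unitOfCoprime]

theorem signedIndicator_pow_of_bracket4_subset (hskew : ∀ s ∈ S, s⁻¹ ∉ S)
    (h4 : ∀ x ∈ S, 4 ∣ orderOf x) (hbr : ∀ x ∈ S, bracket4 x ⊆ (S : Set Γ)) (g : Γ) {k : ℕ}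
    (hk : k.Coprime (4 * Fintype.card Γ)) :
    (signedIndicator S (g ^ k) : ℂ) * Complex.I = signedIndicator S g * Complex.I ^ k := by
  have hcard : 0 < Fintype.card Γ := Fintype.card_pos
  have hord (x : Γ) : orderOf x ∣ 4 * Fintype.card Γ := (orderOf_dvd_card).mul_left 4
  have hmem (x : Γ) {j : ℕ} (hj : j.Coprime (4 * Fintype.card Γ)) (hj1 : j % 4 = 1) :
      x ^ j ∈ S ↔ x ∈ S := by
    refine ⟨fun h => ?_, fun h => pow_mem_of_bracket4_subset h4 hbr h (hord x) hj hj1⟩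
    obtain ⟨l, -, hl⟩ := Nat.exists_mul_mod_eq_one_of_coprime hj (by omega)
    have hl1 : j * l ≡ 1 [MOD 4 * Fintype.card Γ] := by
      rw [Nat.ModEq, hl, Nat.mod_eq_of_lt (by omega)]
    have hlc : l.Coprime (4 * Fintype.card Γ) :=
      Nat.Coprime.coprime_mul_left (k := j) (by
        rw [Nat.Coprime, hl1.gcd_eq, Nat.gcd_one_left])
    have hl4 : l % 4 = 1 := by
      have := hl1.of_mul_right (Fintype.card Γ)
      rw [Nat.ModEq, Nat.mul_mod, hj1] at this
      omega
    have := pow_mem_of_bracket4_subset h4 hbr h (hord _) hlc hl4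
    rwa [← pow_mul, pow_eq_pow_iff_modEq.2 (hl1.of_dvd (hord x)), pow_one] at this
  have hone (x : Γ) {j : ℕ} (hj : j.Coprime (4 * Fintype.card Γ)) (hj1 : j % 4 = 1) :
      signedIndicator S (x ^ j) = signedIndicator S x := by
    simp only [signedIndicator, ← inv_pow, hmem _ hj hj1]
  have hodd : k.Coprime 4 := hk.coprime_dvd_right (dvd_mul_right _ _)
  have hk4 : k % 4 = 1 ∨ k % 4 = 3 := by
    have : k % 2 = 1 := Nat.odd_iff.1 (Nat.coprime_two_right.1
      (hodd.coprime_dvd_right (by norm_num)))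
    omega
  rcases hk4 with h | h
  · rw [hone g hk h, I_pow_of_mod_four_eq_one h]
  · have hpred : (4 * Fintype.card Γ - 1).Coprime (4 * Fintype.card Γ) := by
      rw [Nat.coprime_comm]
      exact Nat.coprime_self_sub_right (by omega) |>.2 (Nat.coprime_one_right _)
    have hmod : k * (4 * Fintype.card Γ - 1) % 4 = 1 := by
      rw [Nat.mul_mod, h, show (4 * Fintype.card Γ - 1) % 4 = 3 by omega]
    have hinv : g ^ k = g⁻¹ ^ (k * (4 * Fintype.card Γ - 1)) := by
      rw [mul_comm, pow_mul]
      congr 1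
      rw [inv_pow, eq_inv_iff_mul_eq_one, ← pow_succ', Nat.sub_add_cancel (by omega), mul_comm,
        pow_mul, pow_card_eq_one, one_pow]
    rw [hinv, hone g⁻¹ (hk.mul_left hpred) hmod, signedIndicator_inv hskew,
      I_pow_of_mod_four_eq_three h]
    push_cast
    ring

theorem signedIndicator_pow_mul_I_of_integral (hskew : ∀ s ∈ S, s⁻¹ ∉ S)
    (hnormal : ∀ s ∈ S, ∀ x : Γ, x * s * x⁻¹ ∈ S)
    (hint : MatrixIntegral (hermitianAdjMatrix S)) {x : Γ} (hx : x ∈ S) {L a : ℕ}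
    (hL : L ∣ 4 * Fintype.card Γ) (hxL : orderOf x ∣ L) (h4L : 4 ∣ L) (ha : a.Coprime L) :
    (signedIndicator S (x ^ a) : ℂ) * Complex.I = Complex.I ^ a := by
  have hcard : 0 < Fintype.card Γ := Fintype.card_pos
  obtain ⟨k, hk, hka⟩ := exists_coprime_modEq (by omega) hL ha
  have hk0 : 0 < k := Nat.pos_of_ne_zero (by rintro rfl; simp at hk)
  have h := signedIndicator_pow_of_integral hskew hnormal hint x (k := k.toPNat hk0) hk
  change (signedIndicator S (x ^ k) : ℂ) * Complex.I = signedIndicator S x * Complex.I ^ k at h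
  rwa [signedIndicator_eq_one_iff.2 hx, Int.cast_one, one_mul,
    pow_eq_pow_iff_modEq.2 (hka.of_dvd hxL), Complex.I_pow_eq_pow_mod k, hka.of_dvd h4L,
    ← Complex.I_pow_eq_pow_mod] at h

theorem four_dvd_orderOf_of_integral (hskew : ∀ s ∈ S, s⁻¹ ∉ S)
    (hnormal : ∀ s ∈ S, ∀ x : Γ, x * s * x⁻¹ ∈ S)
    (hint : MatrixIntegral (hermitianAdjMatrix S)) {x : Γ} (hx : x ∈ S) : 4 ∣ orderOf x := by
  by_contra h4
  obtain ⟨c, hc⟩ : ∃ c, (c * orderOf x + 1) % 4 = 3 := by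
    by_cases h2 : 2 ∣ orderOf x
    · exact ⟨1, by omega⟩
    · exact ⟨2, by omega⟩
  have hcop : (c * orderOf x + 1).Coprime (4 * orderOf x) := by
    refine Nat.Coprime.mul_right ?_ (by simp)
    rw [Nat.coprime_comm, Nat.Coprime, Nat.gcd_rec, hc]
    rfl
  have h := signedIndicator_pow_mul_I_of_integral hskew hnormal hint hx
    (Nat.mul_dvd_mul_left 4 orderOf_dvd_card) (dvd_mul_left _ _) (dvd_mul_right _ _) hcop
  rw [I_pow_of_mod_four_eq_three hc, pow_succ, mul_comm c, pow_mul, pow_orderOf_eq_one, one_pow,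
    one_mul, signedIndicator_eq_one_iff.2 hx, Int.cast_one, one_mul,
    self_eq_neg] at h
  exact Complex.I_ne_zero h

theorem bracket4_subset_of_integral (hskew : ∀ s ∈ S, s⁻¹ ∉ S)
    (hnormal : ∀ s ∈ S, ∀ x : Γ, x * s * x⁻¹ ∈ S)
    (hint : MatrixIntegral (hermitianAdjMatrix S)) {x : Γ} (hx : x ∈ S) :
    bracket4 x ⊆ (S : Set Γ) := by
  rintro _ ⟨k, -, -, hk, hk1, rfl⟩
  have h := signedIndicator_pow_mul_I_of_integral hskew hnormal hint hx
    (orderOf_dvd_card.mul_left 4) dvd_rfl (four_dvd_orderOf_of_integral hskew hnormal hint hx) hk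
  rw [I_pow_of_mod_four_eq_one hk1] at h
  have h1 := mul_right_cancel₀ Complex.I_ne_zero (h.trans (one_mul Complex.I).symm)
  exact signedIndicator_eq_one_iff.1 (by exact_mod_cast h1)

end CayleyGraph

/-- A normal oriented Cayley graph `Cay(Γ, S)` is H-integral if and only if `S ∈ D(Γ)`, i.e.
`S ⊆ Γ(4)` and `⟦x⟧ ⊆ S` for every `x ∈ S`. -/
theorem normal_oriented_cayley_HIntegral_iff
    (Γ : Type) [Group Γ] [Fintype Γ] [DecidableEq Γ]
    (S : Finset Γ) (hS1 : (1 : Γ) ∉ S)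
    (hskew : ∀ s ∈ S, s⁻¹ ∉ S)
    (hnormal : ∀ s ∈ S, ∀ x : Γ, x * s * x⁻¹ ∈ S) :
    MatrixIntegral (hermitianAdjMatrix S)
      ↔ ((∀ x ∈ S, 4 ∣ orderOf x) ∧ ∀ x ∈ S, bracket4 x ⊆ (S : Set Γ)) := by
  refine ⟨fun hint => ⟨fun x hx => four_dvd_orderOf_of_integral hskew hnormal hint hx,
    fun x hx => bracket4_subset_of_integral hskew hnormal hint hx⟩, fun ⟨h4, hbr⟩ => ?_⟩
  exact matrixIntegral_of_signedIndicator_pow hskew hnormal fun g k hk =>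
    signedIndicator_pow_of_bracket4_subset hskew h4 hbr g hk
end
end
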